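/- Let Ω ⊂ ℂ^N be a bounded strongly pseudoconvex domain with C^{2,α}-smooth boundary, α ∈ (0,1]. There exist constants 0 < c < C depending only on Ω such that for every complex geodesic φ : Δ → Ω parametrized so that δ_Ω(φ(0)) = max_{ζ∈Δ} δ_Ω(φ(ζ)), and for every z ∈ φ(Δ): c/(1 − |φ⁻¹(z)|) ≤ δ_Ω(φ(0))/δ_Ω(z) ≤ C/(1 − |φ⁻¹(z)|). -/

import Mathlib

open Metric Set Filter Topology MeasureTheory

noncomputable section

namespace InvDist

/-- Complex Euclidean `N`-space. -/
abbrev E (N : ℕ) := EuclideanSpace ℂ (Fin N)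

variable {N : ℕ}

/-- The paper's Hermitian product `⟨a,b⟩ = ∑ a_j * conj (b_j)`. -/
def herm (a b : E N) : ℂ := ∑ j, a j * (starRingEnd ℂ) (b j)

/-- Euclidean distance to the boundary of `Ω`. -/
def bdist (Ω : Set (E N)) (x : E N) : ℝ := Metric.infDist x (frontier Ω)

/-- `π` selects, for each point of `Ω`, a closest point on the boundary. -/
def IsClosestPointSelection (Ω : Set (E N)) (π : E N → E N) : Prop :=
  ∀ z ∈ Ω, π z ∈ frontier Ω ∧ dist z (π z) = bdist Ω z

/-- `‖v_z‖`: modulus of the complex normal component of `v` with respect to the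
closest boundary point `π z`; the outer unit normal at `π z` is `(π z - z)/‖π z - z‖`. -/
def ncomp (Ω : Set (E N)) (π : E N → E N) (z v : E N) : ℝ :=
  ‖herm v (π z - z)‖ / bdist Ω z

/-- `‖v_z^ℝ‖`: modulus of the real normal component of `v` at `π z`. -/
def ncompR (Ω : Set (E N)) (π : E N → E N) (z v : E N) : ℝ :=
  |(herm v (π z - z)).re| / bdist Ω z

/-- The quantity `A_Ω(z,w)`. -/
def Afun (Ω : Set (E N)) (π : E N → E N) (z w : E N) : ℝ :=
  (ncomp Ω π z (z - w) + ‖z - w‖ ^ 2 + ‖z - w‖ * Real.sqrt (bdist Ω z)) /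
    (Real.sqrt (bdist Ω z) * Real.sqrt (bdist Ω w))

/-- `h_Ω(z,w) = ‖(z-w)_z‖ + ‖z-w‖ δ_Ω(z)^{1/2}`. -/
def hfun (Ω : Set (E N)) (π : E N → E N) (z w : E N) : ℝ :=
  ncomp Ω π z (z - w) + ‖z - w‖ * Real.sqrt (bdist Ω z)

/-- real analogue of `h_Ω`. -/
def hfunR (Ω : Set (E N)) (π : E N → E N) (z w : E N) : ℝ :=
  ncompR Ω π z (z - w) + ‖z - w‖ * Real.sqrt (bdist Ω z)

/-- inverse hyperbolic tangent -/
def artanh (x : ℝ) : ℝ := Real.log ((1 + x) / (1 - x)) / 2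

/-- The Lempert function of `Ω`. -/
def lempert (Ω : Set (E N)) (z w : E N) : ℝ :=
  artanh (sInf { r : ℝ | ∃ φ : ℂ → E N, DifferentiableOn ℂ φ (ball 0 1) ∧
    MapsTo φ (ball (0:ℂ) 1) Ω ∧ φ 0 = z ∧ ∃ a ∈ ball (0:ℂ) 1, φ a = w ∧ r = ‖a‖ })

/-- The Carathéodory distance of `Ω`. -/
def caratheodory (Ω : Set (E N)) (z w : E N) : ℝ :=
  artanh (sSup { r : ℝ | ∃ f : E N → ℂ, DifferentiableOn ℂ f Ω ∧
    MapsTo f Ω (ball (0:ℂ) 1) ∧ f z = 0 ∧ r = ‖f w‖ })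

/-- The Kobayashi distance: the largest pseudodistance not exceeding the Lempert
function, given as an infimum over chains. -/
def kobayashi (Ω : Set (E N)) (z w : E N) : ℝ :=
  sInf { r : ℝ | ∃ (n : ℕ) (p : Fin (n + 1) → E N), p 0 = z ∧ p (Fin.last n) = w ∧
    (∀ i, p i ∈ Ω) ∧ r = ∑ i : Fin n, lempert Ω (p i.castSucc) (p i.succ) }

/-- The Poincaré distance on the unit disc. -/
def poincare (ζ ξ : ℂ) : ℝ := artanh ‖(ζ - ξ) / (1 - (starRingEnd ℂ) ζ * ξ)‖

/-- A complex geodesic of `Ω`. -/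
def IsComplexGeodesic (Ω : Set (E N)) (φ : ℂ → E N) : Prop :=
  DifferentiableOn ℂ φ (ball 0 1) ∧ MapsTo φ (ball (0:ℂ) 1) Ω ∧
    ∀ ζ ∈ ball (0:ℂ) 1, ∀ ξ ∈ ball (0:ℂ) 1, kobayashi Ω (φ ζ) (φ ξ) = poincare ζ ξ

/-- `ρ` is `C^k` on `U` with `α`-Hölder `k`-th derivative. -/
def IsCkHolderOn (k : ℕ) (α : ℝ) (ρ : E N → ℝ) (U : Set (E N)) : Prop :=
  ContDiffOn ℝ k ρ U ∧ ∃ M : ℝ, ∀ x ∈ U, ∀ y ∈ U,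
    ‖iteratedFDeriv ℝ k ρ x - iteratedFDeriv ℝ k ρ y‖ ≤ M * ‖x - y‖ ^ α

/-- The Levi form of `ρ` at `p` evaluated at `v`. -/
def levi (ρ : E N → ℝ) (p v : E N) : ℝ :=
  (iteratedFDeriv ℝ 2 ρ p ![v, v] +
    iteratedFDeriv ℝ 2 ρ p ![(Complex.I : ℂ) • v, (Complex.I : ℂ) • v]) / 4

/-- Bounded strongly pseudoconvex domain with `C^{k,α}`-smooth boundary. -/
def IsStronglyPseudoconvexDomain (k : ℕ) (α : ℝ) (Ω : Set (E N)) : Prop :=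
  IsOpen Ω ∧ IsConnected Ω ∧ Bornology.IsBounded Ω ∧
  ∃ (U : Set (E N)) (ρ : E N → ℝ), IsOpen U ∧ closure Ω ⊆ U ∧
    IsCkHolderOn k α ρ U ∧ Ω = {x ∈ U | ρ x < 0} ∧
    (∀ p ∈ frontier Ω, fderiv ℝ ρ p ≠ 0) ∧
    ∀ p ∈ frontier Ω, ∀ v : E N, v ≠ 0 → fderiv ℝ ρ p v = 0 →
      fderiv ℝ ρ p ((Complex.I : ℂ) • v) = 0 → 0 < levi ρ p v

/-- `η` is the outer unit normal of `Ω` at the boundary point `p`. -/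
def IsOuterUnitNormalAt (Ω : Set (E N)) (p η : E N) : Prop :=
  ‖η‖ = 1 ∧ p ∈ frontier Ω ∧ ∃ ε > 0, ∀ t : ℝ, 0 < t → t < ε →
    p - t • η ∈ Ω ∧ bdist Ω (p - t • η) = t

open Classical in
/-- signed boundary distance -/
def signedDist (Ω : Set (E N)) (x : E N) : ℝ :=
  if x ∈ closure Ω then -(bdist Ω x) else bdist Ω x

/-- Hessian quadratic form of the signed boundary distance. -/
def hessSD (Ω : Set (E N)) (p v : E N) : ℝ :=
  iteratedFDeriv ℝ 2 (signedDist Ω) p ![v, v]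

/-- strict linear convexity at `p` (with outer unit normal `η`). -/
def StrictlyLinearlyConvexAt (Ω : Set (E N)) (p η : E N) : Prop :=
  ∀ v : E N, v ≠ 0 → herm v η = 0 → 0 < hessSD Ω p v

/-- strong convexity at `p` (with outer unit normal `η`). -/
def StronglyConvexAt (Ω : Set (E N)) (p η : E N) : Prop :=
  ∀ v : E N, v ≠ 0 → (herm v η).re = 0 → 0 < hessSD Ω p v

/-- `p` is a `C^k`-smooth boundary point of `Ω`. -/
def IsCkBoundaryPoint (k : ℕ) (Ω : Set (E N)) (p : E N) : Prop :=
  p ∈ frontier Ω ∧ ∃ (U : Set (E N)) (ρ : E N → ℝ), IsOpen U ∧ p ∈ U ∧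
    ContDiffOn ℝ k ρ U ∧ (∀ x ∈ U, (x ∈ Ω ↔ ρ x < 0)) ∧
    ∀ x ∈ U ∩ frontier Ω, fderiv ℝ ρ x ≠ 0

/-- bounded domain with `C^k`-smooth boundary. -/
def IsCkDomain (k : ℕ) (Ω : Set (E N)) : Prop :=
  IsOpen Ω ∧ IsConnected Ω ∧ Bornology.IsBounded Ω ∧
    ∀ p ∈ frontier Ω, IsCkBoundaryPoint k Ω p

/-- bounded domain with `C^{1,1}`-smooth boundary. -/
def IsC11Domain (Ω : Set (E N)) : Prop :=
  IsOpen Ω ∧ IsConnected Ω ∧ Bornology.IsBounded Ω ∧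
  ∀ p ∈ frontier Ω, ∃ (U : Set (E N)) (ρ : E N → ℝ), IsOpen U ∧ p ∈ U ∧
    IsCkHolderOn 1 1 ρ U ∧ (∀ x ∈ U, (x ∈ Ω ↔ ρ x < 0)) ∧
    ∀ x ∈ U ∩ frontier Ω, fderiv ℝ ρ x ≠ 0

/-- `p` is a `C^{2,α}`-smooth strongly pseudoconvex boundary point of `Ω`. -/
def IsSPSCBoundaryPoint (α : ℝ) (Ω : Set (E N)) (p : E N) : Prop :=
  p ∈ frontier Ω ∧ ∃ (U : Set (E N)) (ρ : E N → ℝ), IsOpen U ∧ p ∈ U ∧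
    IsCkHolderOn 2 α ρ U ∧ (∀ x ∈ U, (x ∈ Ω ↔ ρ x < 0)) ∧
    (∀ x ∈ U ∩ frontier Ω, fderiv ℝ ρ x ≠ 0) ∧
    ∀ x ∈ U ∩ frontier Ω, ∀ v : E N, v ≠ 0 → fderiv ℝ ρ x v = 0 →
      fderiv ℝ ρ x ((Complex.I : ℂ) • v) = 0 → 0 < levi ρ x v

instance (N : ℕ) : MeasurableSpace (E N) := borel _

instance (N : ℕ) : BorelSpace (E N) := ⟨rfl⟩

/-- Lebesgue measure on `E N`. -/
def vol (N : ℕ) : Measure (E N) :=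
  letI : InnerProductSpace ℝ (E N) := InnerProductSpace.rclikeToReal ℂ (E N)
  letI : MeasureSpace (E N) := measureSpaceOfInnerProductSpace
  volume

/-- Bergman kernel on the diagonal. -/
def bergmanKernelDiag (Ω : Set (E N)) (z : E N) : ℝ :=
  sSup { r : ℝ | ∃ f : E N → ℂ, DifferentiableOn ℂ f Ω ∧
    (∫ x in Ω, ‖f x‖ ^ 2 ∂(vol N)) ≤ 1 ∧ r = ‖f z‖ ^ 2 }

/-- `M_Ω(z;v)`. -/
def bergmanM (Ω : Set (E N)) (z v : E N) : ℝ :=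
  sSup { r : ℝ | ∃ f : E N → ℂ, DifferentiableOn ℂ f Ω ∧
    (∫ x in Ω, ‖f x‖ ^ 2 ∂(vol N)) ≤ 1 ∧ f z = 0 ∧ r = ‖fderiv ℂ f z v‖ }

/-- The Bergman metric. -/
def bergmanMetric (Ω : Set (E N)) (z v : E N) : ℝ :=
  bergmanM Ω z v / Real.sqrt (bergmanKernelDiag Ω z)

/-- The Bergman distance: inner distance of the Bergman metric. -/
def bergmanDist (Ω : Set (E N)) (z w : E N) : ℝ :=
  sInf { r : ℝ | ∃ γ : ℝ → E N, ContDiffOn ℝ 1 γ (Icc 0 1) ∧ γ 0 = z ∧ γ 1 = w ∧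
    (∀ t ∈ Icc (0:ℝ) 1, γ t ∈ Ω) ∧
    r = ∫ t in (0:ℝ)..(1:ℝ), bergmanMetric Ω (γ t) (derivWithin γ (Icc 0 1) t) }


section Disc

variable {V : Type*} [NormedAddCommGroup V] [NormedSpace ℂ V]

/-- Quantitative data attached to a defining function `r` of a bounded strongly pseudoconvex
domain `Ω`: `D x` is the complex differential `2∂r` at `x`, and `support` provides pluriharmonic
support functions for `r` from below at points close to the boundary. -/
structure PshData (Ω : Set V) (r : V → ℝ) (D : V → V →L[ℂ] ℂ) (η c₀ B : ℝ) : Prop where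
  eta_pos : 0 < η
  c_pos : 0 < c₀
  one_le : 1 ≤ B
  isOpen : IsOpen Ω
  neg : ∀ x ∈ Ω, r x < 0
  neg_le_one : ∀ x ∈ Ω, -r x ≤ 1
  mem : ∀ x ∈ Ω, ∀ y, ‖y - x‖ < η → r y < 0 → y ∈ Ω
  taylor : ∀ x ∈ Ω, ∀ y, ‖y - x‖ < η → |r y - r x - (D x (y - x)).re| ≤ B * ‖y - x‖ ^ 2
  norm_le : ∀ x ∈ Ω, ‖D x‖ ≤ B
  lip : ∀ x ∈ Ω, ∀ y ∈ Ω, ‖D x - D y‖ ≤ B * ‖x - y‖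
  normal : ∀ x ∈ Ω, -r x < c₀ → ∃ ν, D x ν = -1 ∧ ‖ν‖ ≤ B
  support : ∀ x ∈ Ω, -r x < c₀ → ∃ P : V → ℂ, Differentiable ℂ P ∧ P x = 0 ∧
    HasFDerivAt P (D x) x ∧ ∀ y, ‖y - x‖ < η → r x + (P y).re + ‖y - x‖ ^ 2 / B ≤ r y
  diam : ∀ x ∈ Ω, ∀ y ∈ Ω, ‖x - y‖ ≤ B
  compact : ∀ c > 0, IsCompact {x ∈ Ω | c ≤ -r x}
  continuousOn : ContinuousOn r Ω

variable {Ω : Set V} {r : V → ℝ} {D : V → V →L[ℂ] ℂ} {η c₀ B : ℝ}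

theorem PshData.norm_sub_le (h : PshData Ω r D η c₀ B) {ψ : ℂ → V}
    (hψ : DifferentiableOn ℂ ψ (ball 0 1)) (hm : MapsTo ψ (ball 0 1) Ω) {ζ : ℂ}
    (hζ : ‖ζ‖ < 1) : ‖ψ ζ - ψ 0‖ ≤ B * ‖ζ‖ := by
  have := Complex.dist_le_div_mul_dist_of_mapsTo_ball (R₂ := B) hψ (fun z hz => by
    rw [mem_closedBall, dist_eq_norm]
    exact h.diam _ (hm hz) _ (hm (by simp))) (z := ζ) (by simpa using hζ)
  simpa [dist_eq_norm] using this

theorem PshData.exists_disc_bounds (h : PshData Ω r D η c₀ B) :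
    ∃ K s : ℝ, 1 ≤ K ∧ 0 < s ∧ s < 1 ∧ ∀ ψ : ℂ → V, DifferentiableOn ℂ ψ (ball 0 1) →
      MapsTo ψ (ball 0 1) Ω → ‖deriv ψ 0‖ ^ 2 ≤ K * -r (ψ 0) ∧
        ‖D (ψ 0) (deriv ψ 0)‖ ≤ K * -r (ψ 0) ∧
        ∀ ζ : ℂ, ‖ζ‖ < s → -r (ψ ζ) ≤ K * -r (ψ 0) := by
  have hB : 0 < B := by linarith [h.one_le]
  have hη := h.eta_pos
  have hc := h.c_pos
  set s₀ : ℝ := min 1 (η / B) with hs₀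
  have hs₀0 : 0 < s₀ := lt_min one_pos (by positivity)
  set s : ℝ := s₀ / 2 with hs
  have hs0 : 0 < s := by positivity
  have hs01 : s₀ ≤ 1 := min_le_left _ _
  refine ⟨B ^ 2 / c₀ + 1 / c₀ + 3 * B / s ^ 2 + 2 / s + 3, s, ?_, hs0, by linarith, ?_⟩
  · have : 0 ≤ B ^ 2 / c₀ + 1 / c₀ + 3 * B / s ^ 2 + 2 / s := by positivity
    linarith
  intro ψ hψ hm
  have h0 : ψ 0 ∈ Ω := hm (by simp)
  set d := -r (ψ 0) with hd
  have hd0 : 0 < d := by linarith [h.neg _ h0]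
  have k1 : 0 ≤ B ^ 2 / c₀ * d := by positivity
  have k2 : 0 ≤ 1 / c₀ * d := by positivity
  have k3 : 0 ≤ 3 * B / s ^ 2 * d := by positivity
  have k4 : 0 ≤ 2 / s * d := by positivity
  rcases le_or_gt c₀ d with hcd | hcd
  · have hder : ‖deriv ψ 0‖ ≤ B := by
      have := Complex.norm_deriv_le_div_of_mapsTo_ball (R₂ := B) hψ (fun z hz => by
        rw [mem_closedBall, dist_eq_norm]
        exact h.diam _ (hm hz) _ h0) one_pos
      simpa using this
    have e1 : B ^ 2 ≤ B ^ 2 / c₀ * d := by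
      rw [div_mul_eq_mul_div, le_div_iff₀ hc]; gcongr
    have e2 : 1 ≤ 1 / c₀ * d := by
      rw [div_mul_eq_mul_div, le_div_iff₀ hc]; linarith
    refine ⟨?_, ?_, fun ζ hζ => ?_⟩
    · have : ‖deriv ψ 0‖ ^ 2 ≤ B ^ 2 := by gcongr
      linarith
    · have : ‖D (ψ 0) (deriv ψ 0)‖ ≤ B * B :=
        (ContinuousLinearMap.le_opNorm _ _).trans (by gcongr; exact h.norm_le _ h0)
      linarith
    · have := h.neg_le_one _ (hm (show ζ ∈ ball (0 : ℂ) 1 by simp; linarith))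
      linarith
  · obtain ⟨P, hP, hP0, hPd, hPs⟩ := h.support _ h0 hcd
    have hsub : ball (0 : ℂ) s₀ ⊆ ball 0 1 := ball_subset_ball hs01
    have hnear : ∀ ζ ∈ ball (0 : ℂ) s₀, ‖ψ ζ - ψ 0‖ < η := fun ζ hζ => by
      have hζ' : ‖ζ‖ < s₀ := by simpa using hζ
      have h2 : ‖ζ‖ < η / B := hζ'.trans_le (min_le_right _ _)
      rw [lt_div_iff₀ hB] at h2
      linarith [h.norm_sub_le hψ hm (hζ'.trans_le hs01)]
    have hsupp : ∀ ζ ∈ ball (0 : ℂ) s₀,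
        (P (ψ ζ)).re + ‖ψ ζ - ψ 0‖ ^ 2 / B ≤ r (ψ ζ) + d := fun ζ hζ => by
      linarith [hPs _ (hnear ζ hζ)]
    have hgd : DifferentiableOn ℂ (fun ζ => P (ψ ζ)) (ball 0 s₀) :=
      hP.comp_differentiableOn (hψ.mono hsub)
    have hre : ∀ ζ ∈ ball (0 : ℂ) s₀, (P (ψ ζ)).re ≤ d := fun ζ hζ => by
      have := hsupp ζ hζ
      have := h.neg _ (hm (hsub hζ))
      have : 0 ≤ ‖ψ ζ - ψ 0‖ ^ 2 / B := by positivity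
      linarith
    have hg : ∀ ζ ∈ ball (0 : ℂ) s, ‖P (ψ ζ)‖ ≤ 2 * d := fun ζ hζ => by
      have hζ' : ‖ζ‖ < s := by simpa using hζ
      have := Complex.borelCaratheodory_zero hd0 hgd hre hs₀0 (z := ζ)
        (by simp; linarith) hP0
      refine this.trans ?_
      rw [div_le_iff₀ (by linarith)]
      gcongr
      linarith
    have hss : ball (0 : ℂ) s ⊆ ball 0 s₀ := ball_subset_ball (by linarith)
    have hψd : HasDerivAt ψ (deriv ψ 0) 0 :=
      (hψ.differentiableAt (isOpen_ball.mem_nhds (by simp))).hasDerivAt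
    refine ⟨?_, ?_, fun ζ hζ => ?_⟩
    · have := Complex.norm_deriv_le_div_of_mapsTo_ball (R₂ := √(3 * B * d))
        (hψ.mono (hss.trans hsub)) (fun z hz => by
          rw [mem_closedBall, dist_eq_norm]
          apply Real.le_sqrt_of_sq_le
          have h1 := hsupp z (hss hz)
          have h2 := h.neg _ (hm (hsub (hss hz)))
          have h3 := (abs_le.1 ((Complex.abs_re_le_norm _).trans (hg z hz))).1
          have h4 : ‖ψ z - ψ 0‖ ^ 2 / B ≤ 3 * d := by linarith
          rw [div_le_iff₀ hB] at h4
          linarith) hs0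
      have h5 : ‖deriv ψ 0‖ ^ 2 ≤ (√(3 * B * d) / s) ^ 2 := by gcongr
      rw [div_pow, Real.sq_sqrt (by positivity)] at h5
      have : 3 * B * d / s ^ 2 = 3 * B / s ^ 2 * d := by ring
      linarith
    · have hgder : HasDerivAt (fun ζ => P (ψ ζ)) (D (ψ 0) (deriv ψ 0)) 0 :=
        HasFDerivAt.comp_hasDerivAt 0 hPd hψd
      have := Complex.norm_deriv_le_div_of_mapsTo_ball (R₂ := 2 * d) (hgd.mono hss)
        (fun z hz => by
          rw [mem_closedBall, dist_eq_norm, hP0, sub_zero]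
          exact hg z hz) hs0
      rw [hgder.deriv] at this
      have e : 2 * d / s = 2 / s * d := by ring
      linarith
    · have hζ' : ζ ∈ ball (0 : ℂ) s := by simpa using hζ
      have h1 := hsupp ζ (hss hζ')
      have h3 := (abs_le.1 ((Complex.abs_re_le_norm _).trans (hg ζ hζ'))).1
      have : 0 ≤ ‖ψ ζ - ψ 0‖ ^ 2 / B := by positivity
      linarith

/-- The affine reparametrization of a disc centred at an interior point of the unit disc. -/
theorem PshData.exists_disc_deriv_bounds (h : PshData Ω r D η c₀ B) :
    ∃ K : ℝ, 1 ≤ K ∧ ∀ φ : ℂ → V, DifferentiableOn ℂ φ (ball 0 1) →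
      MapsTo φ (ball 0 1) Ω → ∀ ξ : ℂ, ‖ξ‖ < 1 →
        (‖deriv φ ξ‖ * (1 - ‖ξ‖)) ^ 2 ≤ K * -r (φ ξ) ∧
        ‖D (φ ξ) (deriv φ ξ)‖ * (1 - ‖ξ‖) ≤ K * -r (φ ξ) := by
  obtain ⟨K, s, hK, -, -, H⟩ := h.exists_disc_bounds
  refine ⟨K, hK, fun φ hφ hm ξ hξ => ?_⟩
  have ht : 0 < 1 - ‖ξ‖ := by linarith
  set t : ℝ := 1 - ‖ξ‖ with htdef
  have hmaps : MapsTo (fun ζ : ℂ => ξ + (t : ℂ) * ζ) (ball 0 1) (ball 0 1) := fun ζ hζ => by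
    have hζ' : ‖ζ‖ < 1 := by simpa using hζ
    have : ‖ξ + (t : ℂ) * ζ‖ ≤ ‖ξ‖ + t * ‖ζ‖ := by
      refine (norm_add_le _ _).trans_eq ?_
      rw [norm_mul, Complex.norm_of_nonneg ht.le]
    have h2 : t * ‖ζ‖ < t * 1 := by gcongr
    rw [mem_ball_zero_iff]
    linarith
  obtain ⟨h1, h2, -⟩ := H (fun ζ => φ (ξ + (t : ℂ) * ζ))
    (hφ.comp (by fun_prop) hmaps) (hm.comp hmaps)
  have hd : deriv (fun ζ : ℂ => φ (ξ + (t : ℂ) * ζ)) 0 = (t : ℂ) • deriv φ ξ := by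
    have hφd : HasDerivAt φ (deriv φ ξ) (ξ + (t : ℂ) * 0) := by
      simpa using (hφ.differentiableAt (isOpen_ball.mem_nhds (by simpa using hξ))).hasDerivAt
    have hl : HasDerivAt (fun ζ : ℂ => ξ + (t : ℂ) * ζ) (t : ℂ) 0 := by
      simpa using ((hasDerivAt_id (0 : ℂ)).const_mul (t : ℂ)).const_add ξ
    exact (hφd.scomp (0 : ℂ) hl).deriv
  rw [hd] at h1 h2
  simp only [mul_zero, add_zero, map_smul, norm_smul, Complex.norm_of_nonneg ht.le] at h1 h2
  exact ⟨by rw [mul_comm]; exact h1, by rw [mul_comm]; exact h2⟩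

/-- Along discs the defining function is comparable at points of `{‖ζ‖ ≤ 1/2}`. -/
theorem PshData.exists_half_disc_bound (h : PshData Ω r D η c₀ B) :
    ∃ K : ℝ, 1 ≤ K ∧ ∀ φ : ℂ → V, DifferentiableOn ℂ φ (ball 0 1) →
      MapsTo φ (ball 0 1) Ω → ∀ ξ : ℂ, ‖ξ‖ ≤ 1 / 2 → -r (φ 0) ≤ K * -r (φ ξ) := by
  obtain ⟨K, s, hK, hs, hs1, H⟩ := h.exists_disc_bounds
  obtain ⟨n, hn⟩ := exists_nat_gt (1 / s)
  have hn0 : (0 : ℝ) < n := lt_trans (by positivity) hn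
  refine ⟨K ^ n, one_le_pow₀ hK, fun φ hφ hm ξ hξ => ?_⟩
  have step : ∀ z w : ℂ, ‖z‖ ≤ 1 / 2 → ‖w - z‖ < s / 2 → -r (φ w) ≤ K * -r (φ z) := by
    intro z w hz hw
    have hmaps : MapsTo (fun ζ : ℂ => z + ζ / 2) (ball 0 1) (ball 0 1) := fun ζ hζ => by
      have hζ' : ‖ζ‖ < 1 := by simpa using hζ
      have : ‖z + ζ / 2‖ ≤ ‖z‖ + ‖ζ‖ / 2 := by
        refine (norm_add_le _ _).trans_eq ?_
        simp
      rw [mem_ball_zero_iff]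
      linarith
    obtain ⟨-, -, h3⟩ := H (fun ζ => φ (z + ζ / 2))
      (hφ.comp (by fun_prop) hmaps) (hm.comp hmaps)
    have := h3 (2 * (w - z)) (by rw [norm_mul]; simp; linarith)
    simpa using this
  have key : ∀ k : ℕ, k ≤ n → -r (φ (ξ * (1 - k / n : ℝ))) ≤ K ^ k * -r (φ ξ) := by
    intro k
    induction k with
    | zero => intro _; simp
    | succ k ih =>
      intro hk
      have hkn : (k : ℝ) ≤ n := by exact_mod_cast (Nat.le_succ k).trans hk
      have h1 : 0 ≤ 1 - (k : ℝ) / n := by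
        rw [sub_nonneg, div_le_one hn0]; exact hkn
      have h1' : 1 - (k : ℝ) / n ≤ 1 := by
        have : 0 ≤ (k : ℝ) / n := by positivity
        linarith
      have h2 := step (ξ * (1 - k / n : ℝ)) (ξ * (1 - (k + 1 : ℕ) / n : ℝ)) (by
          rw [norm_mul, Complex.norm_of_nonneg h1]
          nlinarith [norm_nonneg ξ]) (by
          rw [← mul_sub, norm_mul, ← Complex.ofReal_sub]
          have : (1 - ((k + 1 : ℕ) : ℝ) / n) - (1 - (k : ℝ) / n) = -(1 / n) := by
            push_cast; ring
          rw [this, Complex.norm_real, norm_neg, Real.norm_of_nonneg (by positivity)]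
          have h4 : 1 / (n : ℝ) < s := by
            rw [div_lt_iff₀ hn0]; rw [div_lt_iff₀ hs] at hn; linarith
          have h5 : 0 < 1 / (n : ℝ) := by positivity
          nlinarith [norm_nonneg ξ])
      calc _ ≤ _ := h2
        _ ≤ K * (K ^ k * -r (φ ξ)) := by
          gcongr; exact ih ((Nat.le_succ k).trans hk)
        _ = _ := by ring
  have := key n le_rfl
  rwa [div_self hn0.ne', sub_self, Complex.ofReal_zero, mul_zero] at this

/-- Comparison of `r` along a non-constant disc with the Green function of the unit disc. -/
theorem PshData.exists_lower_bound [CompleteSpace V] (h : PshData Ω r D η c₀ B) :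
    ∃ κ : ℝ, 0 < κ ∧ ∀ φ : ℂ → V, DifferentiableOn ℂ φ (ball 0 1) →
      MapsTo φ (ball 0 1) Ω → (∃ a ∈ ball (0 : ℂ) 1, φ a ≠ φ 0) →
        ∀ ζ : ℂ, ‖ζ‖ < 1 → κ * (1 - ‖ζ‖) * -r (φ 0) ≤ -r (φ ζ) := by
  obtain ⟨K, hK, H⟩ := h.exists_half_disc_bound
  have hc := h.c_pos
  have hB : 0 < B := by linarith [h.one_le]
  have hK0 : 0 < K := by linarith
  have hmin : 0 < min K⁻¹ c₀ := lt_min (by positivity) hc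
  refine ⟨min K⁻¹ c₀, hmin, fun φ hφ hm hne ζ₁ hζ₁ => ?_⟩
  have h0 : φ 0 ∈ Ω := hm (by simp)
  have hd0 : 0 < -r (φ 0) := by linarith [h.neg _ h0]
  have hd1 := h.neg_le_one _ h0
  set κ : ℝ := min K⁻¹ c₀ * -r (φ 0) with hκ
  have hκ0 : 0 < κ := by positivity
  have hκc : κ ≤ c₀ := by
    have : min K⁻¹ c₀ ≤ c₀ := min_le_right _ _
    nlinarith
  have hκK : ∀ ξ : ℂ, ‖ξ‖ ≤ 1 / 2 → κ ≤ -r (φ ξ) := fun ξ hξ => by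
    have h1 := H φ hφ hm ξ hξ
    have h2 : min K⁻¹ c₀ * -r (φ 0) ≤ K⁻¹ * (K * -r (φ ξ)) := by
      gcongr
      exact min_le_left _ _
    rwa [inv_mul_cancel_left₀ hK0.ne'] at h2
  have hgoal : κ * (1 - ‖ζ₁‖) ≤ -r (φ ζ₁) →
      min K⁻¹ c₀ * (1 - ‖ζ₁‖) * -r (φ 0) ≤ -r (φ ζ₁) := fun h => by
    rw [hκ] at h; linarith
  apply hgoal
  rcases le_or_gt ‖ζ₁‖ (1 / 2) with hle | hgt
  · have := hκK ζ₁ hle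
    nlinarith [norm_nonneg ζ₁]
  by_contra! hcon
  have hlog1 : 1 - ‖ζ₁‖ ≤ -Real.log ‖ζ₁‖ := by
    linarith [Real.log_le_sub_one_of_pos (show 0 < ‖ζ₁‖ by linarith)]
  set w : ℂ → ℝ := fun ζ => r (φ ζ) - κ * Real.log ‖ζ‖ with hw
  have hw1 : 0 < w ζ₁ := by
    simp only [hw]
    nlinarith
  obtain ⟨s, hs1, hsζ, hs⟩ : ∃ s : ℝ, s < 1 ∧ ‖ζ₁‖ < s ∧ -(κ * Real.log s) < w ζ₁ := by
    have hcont : Tendsto (fun s : ℝ => -(κ * Real.log s)) (𝓝[<] 1) (𝓝 0) := by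
      have : ContinuousAt (fun s : ℝ => -(κ * Real.log s)) 1 := by
        have := Real.continuousAt_log (one_ne_zero)
        fun_prop
      simpa using this.tendsto.mono_left (nhdsWithin_le_nhds (s := Iio 1))
    have e1 := hcont.eventually (gt_mem_nhds hw1)
    have e2 : ∀ᶠ s : ℝ in 𝓝[<] 1, s < 1 := eventually_mem_nhdsWithin
    have e3 : ∀ᶠ s : ℝ in 𝓝[<] 1, ‖ζ₁‖ < s := nhdsWithin_le_nhds (lt_mem_nhds hζ₁)
    obtain ⟨s, a, b, c⟩ := (e1.and (e2.and e3)).exists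
    exact ⟨s, b, c, a⟩
  set A : Set ℂ := closedBall 0 s ∩ {ζ | 1 / 2 ≤ ‖ζ‖} with hA
  have hAc : IsCompact A :=
    (isCompact_closedBall 0 s).inter_right (isClosed_le continuous_const continuous_norm)
  have hA1 : A ⊆ ball 0 1 := fun z hz => by
    have := hz.1
    simp only [mem_closedBall_zero_iff] at this
    simp; linarith
  have hwc : ContinuousOn w A := by
    refine (h.continuousOn.comp (hφ.continuousOn.mono hA1) (hm.mono_left hA1)).sub
      (continuousOn_const.mul (ContinuousOn.log continuous_norm.continuousOn fun z hz => ?_))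
    have : 1 / 2 ≤ ‖z‖ := hz.2
    intro h; linarith
  have hζA : ζ₁ ∈ A := ⟨by simpa using hsζ.le, hgt.le⟩
  obtain ⟨z, hzA, hzmax⟩ := hAc.exists_isMaxOn ⟨_, hζA⟩ hwc
  have hwz : w ζ₁ ≤ w z := hzmax hζA
  have hz1 : ‖z‖ < 1 := by simpa using hA1 hzA
  have hz2 : 1 / 2 ≤ ‖z‖ := hzA.2
  have hzneg := h.neg _ (hm (hA1 hzA))
  have hzs : ‖z‖ < s := by
    refine lt_of_le_of_ne (by simpa using hzA.1) fun e => ?_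
    simp only [hw, e] at hwz hs
    linarith
  have hlog : -Real.log ‖z‖ < 1 := by
    have h1 : -Real.log ‖z‖ ≤ Real.log 2 := by
      rw [← Real.log_inv]
      apply Real.log_le_log (by positivity)
      rw [inv_le_comm₀ (by linarith) (by norm_num)]
      linarith
    linarith [Real.log_two_lt_d9]
  have hzκ : -r (φ z) < κ := by
    have : 0 < r (φ z) - κ * Real.log ‖z‖ := lt_of_lt_of_le hw1 hwz
    nlinarith
  have hzh : 1 / 2 < ‖z‖ := by
    refine lt_of_le_of_ne hz2 fun e => ?_
    linarith [hκK z e.ge]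
  have hnhds : ∀ᶠ ζ in 𝓝 z, ζ ∈ A := by
    filter_upwards [continuous_norm.continuousAt.eventually (gt_mem_nhds hzs),
      continuous_norm.continuousAt.eventually (lt_mem_nhds hzh)] with ζ h1 h2
    exact ⟨by simpa using h1.le, h2.le⟩
  have hzball : ball (0 : ℂ) 1 ∈ 𝓝 z := isOpen_ball.mem_nhds (hA1 hzA)
  obtain ⟨P, hP, hP0, -, hPs⟩ := h.support _ (hm (hA1 hzA)) (hzκ.trans_le hκc)
  have hφz : ContinuousAt φ z := (hφ.differentiableAt hzball).continuousAt
  have hnear : ∀ᶠ ζ in 𝓝 z, ‖φ ζ - φ z‖ < η := by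
    have : Tendsto (fun ζ => ‖φ ζ - φ z‖) (𝓝 z) (𝓝 0) := by
      simpa using (hφz.sub (continuousAt_const (y := φ z))).norm.tendsto
    exact this.eventually (gt_mem_nhds h.eta_pos)
  set g : ℂ → ℂ := fun ζ => Complex.exp (P (φ ζ) / κ) / ζ with hg
  have hgn : ∀ ζ ∈ A, ‖g ζ‖ = Real.exp ((P (φ ζ)).re / κ - Real.log ‖ζ‖) := by
    intro ζ hζ
    have : 0 < ‖ζ‖ := by linarith [show 1 / 2 ≤ ‖ζ‖ from hζ.2]
    simp only [hg, norm_div, Complex.norm_exp, Complex.div_ofReal_re]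
    rw [Real.exp_sub, Real.exp_log this]
  have hkey : ∀ᶠ ζ in 𝓝 z, (P (φ ζ)).re / κ - Real.log ‖ζ‖ + ‖φ ζ - φ z‖ ^ 2 / (B * κ) ≤
      (P (φ z)).re / κ - Real.log ‖z‖ := by
    filter_upwards [hnhds, hnear] with ζ hζA hζn
    have h1 := hPs _ hζn
    have h2 : w ζ ≤ w z := hzmax hζA
    simp only [hw] at h2
    rw [hP0]
    have h3 : (P (φ ζ)).re - κ * Real.log ‖ζ‖ + ‖φ ζ - φ z‖ ^ 2 / B ≤ -κ * Real.log ‖z‖ := by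
      linarith
    have h4 := div_le_div_of_nonneg_right h3 hκ0.le
    have e1 : ((P (φ ζ)).re - κ * Real.log ‖ζ‖ + ‖φ ζ - φ z‖ ^ 2 / B) / κ =
      (P (φ ζ)).re / κ - Real.log ‖ζ‖ + ‖φ ζ - φ z‖ ^ 2 / (B * κ) := by
      field_simp
    have e2 : -κ * Real.log ‖z‖ / κ = (0 : ℂ).re / κ - Real.log ‖z‖ := by
      rw [Complex.zero_re, zero_div, neg_mul, neg_div, mul_div_cancel_left₀ _ hκ0.ne', zero_sub]
    linarith
  have hgmax : IsLocalMax (norm ∘ g) z := by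
    filter_upwards [hkey, hnhds] with ζ h1 h2
    simp only [Function.comp]
    rw [hgn ζ h2, hgn z hzA]
    apply Real.exp_le_exp.2
    have : 0 ≤ ‖φ ζ - φ z‖ ^ 2 / (B * κ) := by positivity
    linarith
  have hgd : ∀ᶠ ζ in 𝓝 z, DifferentiableAt ℂ g ζ := by
    filter_upwards [hnhds] with ζ h2
    have hζ0 : ζ ≠ 0 := by
      rintro rfl
      have := h2.2
      simp at this
      linarith
    have h3 : DifferentiableAt ℂ φ ζ := hφ.differentiableAt (isOpen_ball.mem_nhds (hA1 h2))
    have h4 : DifferentiableAt ℂ (fun ζ => P (φ ζ)) ζ := (hP _).comp ζ h3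
    exact ((h4.div_const _).cexp).div differentiableAt_id hζ0
  have hconst : φ =ᶠ[𝓝 z] fun _ => φ z := by
    filter_upwards [Complex.norm_eventually_eq_of_isLocalMax hgd hgmax, hkey, hnhds]
      with ζ h1 h2 h3
    rw [hgn ζ h3, hgn z hzA] at h1
    have h4 := Real.exp_injective h1
    have h5 : ‖φ ζ - φ z‖ ^ 2 / (B * κ) ≤ 0 := by linarith
    rw [div_le_iff₀ (by positivity), zero_mul] at h5
    have h6 : ‖φ ζ - φ z‖ = 0 := by nlinarith [norm_nonneg (φ ζ - φ z)]
    rwa [norm_eq_zero, sub_eq_zero] at h6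
  obtain ⟨a, ha, hane⟩ := hne
  have := AnalyticOnNhd.eqOn_of_preconnected_of_eventuallyEq
    (hφ.analyticOnNhd isOpen_ball) analyticOnNhd_const
    (convex_ball (0 : ℂ) 1).isPreconnected (hA1 hzA) hconst
  exact hane ((this ha).trans (this (by simp : (0 : ℂ) ∈ ball (0 : ℂ) 1)).symm)

end Disc

section Path

/-- Integration of a power-type bound on a derivative. -/
theorem norm_le_of_norm_deriv_le_rpow {F : Type*} [NormedAddCommGroup F] [NormedSpace ℝ F]
    {f f' : ℝ → F} {A σ T : ℝ} (hσ : σ ≠ 0) (hA : 0 ≤ A) (hT0 : 0 ≤ T) (hT : T < 1)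
    (hf : ∀ t ∈ Icc 0 T, HasDerivAt f (f' t) t) (hf0 : f 0 = 0)
    (hf' : ∀ t ∈ Icc 0 T, ‖f' t‖ ≤ A * (1 - t) ^ (σ - 1)) :
    ‖f T‖ ≤ A / |σ| * max 1 ((1 - T) ^ σ) := by
  have hder : ∀ t ∈ Icc 0 T, HasDerivAt (fun t : ℝ => A / σ * (1 - (1 - t) ^ σ))
      (A * (1 - t) ^ (σ - 1)) t := by
    intro t ht
    have h1 : 0 < 1 - t := by linarith [ht.2]
    have h2 : HasDerivAt (fun t : ℝ => (1 - t) ^ σ) (-1 * σ * (1 - t) ^ (σ - 1)) t :=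
      ((hasDerivAt_id t).const_sub 1).rpow_const (Or.inl h1.ne')
    refine ((h2.const_sub 1).const_mul (A / σ)).congr_deriv ?_
    rw [show A / σ * -(-1 * σ * (1 - t) ^ (σ - 1)) = A * (1 - t) ^ (σ - 1) * (σ / σ) by ring,
      div_self hσ, mul_one]
  have key := image_norm_le_of_norm_deriv_right_le_deriv_boundary' (a := 0) (b := T)
    (fun t ht => (hf t ht).continuousAt.continuousWithinAt)
    (fun t ht => (hf t (Ico_subset_Icc_self ht)).hasDerivWithinAt)
    (B := fun t : ℝ => A / σ * (1 - (1 - t) ^ σ)) (by simp [hf0])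
    (fun t ht => (hder t ht).continuousAt.continuousWithinAt)
    (fun t ht => (hder t (Ico_subset_Icc_self ht)).hasDerivWithinAt)
    (fun t ht => hf' t (Ico_subset_Icc_self ht)) (right_mem_Icc.2 hT0)
  refine key.trans ?_
  have hx : 0 < (1 - T) ^ σ := Real.rpow_pos_of_pos (by linarith) _
  rcases hσ.lt_or_gt with h | h
  · rw [abs_of_neg h]
    have : 0 ≤ A / -σ := div_nonneg hA (by linarith)
    rw [show A / σ * (1 - (1 - T) ^ σ) = A / -σ * ((1 - T) ^ σ - 1) by rw [div_neg]; ring]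
    refine mul_le_mul_of_nonneg_left ?_ this
    linarith [le_max_right 1 ((1 - T) ^ σ)]
  · rw [abs_of_pos h]
    have : 0 ≤ A / σ := div_nonneg hA h.le
    refine mul_le_mul_of_nonneg_left ?_ this
    linarith [le_max_left 1 ((1 - T) ^ σ)]

variable {V : Type*} [NormedAddCommGroup V] [NormedSpace ℂ V]
variable {Ω : Set V} {r : V → ℝ} {D : V → V →L[ℂ] ℂ} {η c₀ B : ℝ}

theorem PshData.exists_displacement_bound (h : PshData Ω r D η c₀ B) {σ : ℝ} (hσ : σ ≠ 0) :
    ∃ C : ℝ, 1 ≤ C ∧ ∀ φ : ℂ → V, DifferentiableOn ℂ φ (ball 0 1) →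
      MapsTo φ (ball 0 1) Ω → ∀ H : ℝ, ∀ ζ : ℂ, ‖ζ‖ < 1 →
        (∀ ξ : ℂ, ‖ξ‖ ≤ ‖ζ‖ → -r (φ ξ) ≤ H * (1 - ‖ξ‖) ^ (2 * σ)) →
          ‖φ ζ - φ 0‖ ≤ C * √H * max 1 ((1 - ‖ζ‖) ^ σ) ∧
          ‖D (φ 0) (φ ζ - φ 0)‖ ≤ (C * √H * max 1 ((1 - ‖ζ‖) ^ σ)) ^ 2 := by
  obtain ⟨K, hK, hder⟩ := h.exists_disc_deriv_bounds
  have hσ' : 0 < |σ| := abs_pos.2 hσ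
  have hB : 0 < B := by linarith [h.one_le]
  set C₁ : ℝ := K / |σ| with hC₁
  have hC₁0 : 0 < C₁ := by positivity
  set C₂ : ℝ := (K + B * (C₁ * K)) / |σ| with hC₂
  have hC₂0 : 0 < C₂ := by positivity
  refine ⟨1 + C₁ + C₂, by linarith, fun φ hφ hm H ζ hζ hH => ?_⟩
  have h0 : φ 0 ∈ Ω := hm (by simp)
  have hHpos : 0 < H := by
    have := hH 0 (by simp)
    simp only [norm_zero, sub_zero, Real.one_rpow, mul_one] at this
    linarith [h.neg _ h0]
  set T := ‖ζ‖ with hT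
  have hT0 : 0 ≤ T := norm_nonneg ζ
  obtain ⟨ω, hω, hζω⟩ : ∃ ω : ℂ, ‖ω‖ = 1 ∧ (T : ℂ) * ω = ζ := by
    by_cases hz : ζ = 0
    · exact ⟨1, by simp, by simp [hT, hz]⟩
    · have : (‖ζ‖ : ℂ) ≠ 0 := by simpa using hz
      refine ⟨ζ / ‖ζ‖, ?_, ?_⟩
      · rw [norm_div, Complex.norm_real, norm_norm, div_self (by simpa using hz)]
      · rw [hT]; field_simp
  have hnorm : ∀ t : ℝ, 0 ≤ t → ‖(t : ℂ) * ω‖ = t := fun t ht => by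
    rw [norm_mul, hω, mul_one, Complex.norm_of_nonneg ht]
  set γ : ℝ → V := fun t => φ ((t : ℂ) * ω) - φ 0 with hγ
  have hγd : ∀ t ∈ Icc 0 T, HasDerivAt γ (ω • deriv φ ((t : ℂ) * ω)) t := by
    intro t ht
    have h1 : HasDerivAt φ (deriv φ ((t : ℂ) * ω)) ((t : ℂ) * ω) :=
      (hφ.differentiableAt (isOpen_ball.mem_nhds
        (by rw [mem_ball_zero_iff, hnorm t ht.1]; linarith [ht.2]))).hasDerivAt
    have h2 : HasDerivAt (fun t : ℝ => (t : ℂ) * ω) ω t := by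
      simpa using (Complex.ofRealCLM.hasDerivAt (x := t)).mul_const ω
    exact (h1.scomp t h2).sub_const _
  have hpow : ∀ t ∈ Icc 0 T, -r (φ ((t : ℂ) * ω)) ≤ H * ((1 - t) ^ σ) ^ 2 := by
    intro t ht
    have h1 := hH ((t : ℂ) * ω) (by rw [hnorm t ht.1]; exact ht.2)
    rw [hnorm t ht.1, mul_comm 2 σ, Real.rpow_mul (by linarith [ht.2])] at h1
    exact_mod_cast h1
  have hsplit : ∀ t ∈ Icc 0 T, (1 - t) ^ (σ - 1) = (1 - t) ^ σ / (1 - t) := fun t ht => by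
    rw [Real.rpow_sub_one]
    linarith [ht.2]
  have hbd : ∀ t ∈ Icc 0 T, ‖ω • deriv φ ((t : ℂ) * ω)‖ ≤ (K * √H) * (1 - t) ^ (σ - 1) := by
    intro t ht
    have h1t : 0 < 1 - t := by linarith [ht.2]
    have hp := Real.rpow_pos_of_pos h1t σ
    have h1 := (hder φ hφ hm ((t : ℂ) * ω) (by rw [hnorm t ht.1]; linarith)).1
    rw [hnorm t ht.1] at h1
    rw [norm_smul, hω, one_mul, hsplit t ht, ← mul_div_assoc, le_div_iff₀ h1t]
    refine le_of_sq_le_sq ?_ (by positivity)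
    refine h1.trans ?_
    rw [mul_pow, mul_pow, Real.sq_sqrt hHpos.le]
    have h2 := hpow t ht
    calc K * -r (φ ((t : ℂ) * ω)) ≤ K * (H * ((1 - t) ^ σ) ^ 2) := by gcongr
      _ ≤ K ^ 2 * (H * ((1 - t) ^ σ) ^ 2) := by gcongr; nlinarith
      _ = _ := by ring
  have hmax : ∀ t ∈ Icc 0 T, max 1 ((1 - t) ^ σ) ≤ max 1 ((1 - T) ^ σ) := by
    intro t ht
    have h1t : 0 < 1 - t := by linarith [ht.2]
    refine max_le (le_max_left _ _) ?_
    rcases hσ.lt_or_gt with hs | hs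
    · exact (Real.rpow_le_rpow_of_nonpos (by linarith) (by linarith [ht.2]) hs.le).trans
        (le_max_right _ _)
    · exact (Real.rpow_le_one h1t.le (by linarith [ht.1]) hs.le).trans (le_max_left _ _)
  set m := max 1 ((1 - T) ^ σ) with hmdef
  have hm1 : 1 ≤ m := le_max_left _ _
  have hdisp : ∀ t ∈ Icc 0 T, ‖γ t‖ ≤ C₁ * √H * m := by
    intro t ht
    have := norm_le_of_norm_deriv_le_rpow hσ (A := K * √H) (by positivity) ht.1
      (by linarith [ht.2]) (fun s hs => hγd s ⟨hs.1, hs.2.trans ht.2⟩) (by simp [hγ])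
      (fun s hs => hbd s ⟨hs.1, hs.2.trans ht.2⟩)
    refine this.trans ?_
    have e : K * √H / |σ| = C₁ * √H := by rw [hC₁]; ring
    rw [e]
    gcongr
    exact hmax t ht
  have hTm : T ∈ Icc 0 T := right_mem_Icc.2 hT0
  have hγT : γ T = φ ζ - φ 0 := by simp only [hγ, hζω]
  have hC : C₁ ≤ 1 + C₁ + C₂ := by linarith
  refine ⟨?_, ?_⟩
  · rw [← hγT]
    refine (hdisp T hTm).trans ?_
    gcongr
  · have hn := norm_le_of_norm_deriv_le_rpow hσ (A := (K + B * (C₁ * K)) * H * m)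
      (f := fun t => D (φ 0) (γ t)) (f' := fun t => D (φ 0) (ω • deriv φ ((t : ℂ) * ω)))
      (by positivity) hT0 hζ
      (fun t ht => ((D (φ 0)).restrictScalars ℝ).hasFDerivAt.comp_hasDerivAt t (hγd t ht))
      (by simp [hγ]) (fun t ht => by
        have h1t : 0 < 1 - t := by linarith [ht.2]
        have hp := Real.rpow_pos_of_pos h1t σ
        have hball : (t : ℂ) * ω ∈ ball (0 : ℂ) 1 := by
          rw [mem_ball_zero_iff, hnorm t ht.1]; linarith
        set y := φ ((t : ℂ) * ω) with hy
        set v := ω • deriv φ ((t : ℂ) * ω) with hv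
        have e1 : ‖D y v‖ ≤ K * H * m * (1 - t) ^ (σ - 1) := by
          have h1 := (hder φ hφ hm ((t : ℂ) * ω) (by simpa using hball)).2
          rw [hnorm t ht.1] at h1
          rw [hv, map_smul, norm_smul, hω, one_mul, hsplit t ht, ← mul_div_assoc,
            le_div_iff₀ h1t]
          refine h1.trans ?_
          calc K * -r y ≤ K * (H * ((1 - t) ^ σ) ^ 2) := by gcongr; exact hpow t ht
            _ = K * H * (1 - t) ^ σ * (1 - t) ^ σ := by ring
            _ ≤ K * H * m * (1 - t) ^ σ := by
              gcongr
              exact (le_max_right _ _).trans (hmax t ht)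
        have e2 : ‖(D (φ 0) - D y) v‖ ≤ B * (C₁ * K) * H * m * (1 - t) ^ (σ - 1) := by
          refine (ContinuousLinearMap.le_opNorm _ _).trans ?_
          have h1 := h.lip _ h0 _ (hm hball)
          rw [norm_sub_rev (φ 0)] at h1
          calc ‖D (φ 0) - D y‖ * ‖v‖
              ≤ (B * (C₁ * √H * m)) * (K * √H * (1 - t) ^ (σ - 1)) := by
                gcongr
                · exact h1.trans (by gcongr; exact hdisp t ht)
                · exact hbd t ht
            _ = B * (C₁ * K) * (√H * √H) * m * (1 - t) ^ (σ - 1) := by ring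
            _ = _ := by rw [Real.mul_self_sqrt hHpos.le]
        have e3 : D (φ 0) v = D y v + (D (φ 0) - D y) v := by simp
        rw [e3]
        refine (norm_add_le _ _).trans ((add_le_add e1 e2).trans_eq ?_)
        ring)
    simp only [hγT] at hn
    refine hn.trans ?_
    rw [← hmdef, mul_pow, mul_pow, Real.sq_sqrt hHpos.le]
    have e : (K + B * (C₁ * K)) * H * m / |σ| * m = C₂ * H * m ^ 2 := by rw [hC₂]; ring
    rw [e]
    gcongr
    nlinarith

end Path

section Kobayashi

theorem artanh_zero : artanh 0 = 0 := by simp [artanh]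

theorem artanh_mono {x y : ℝ} (hx : 0 ≤ x) (hxy : x ≤ y) (hy : y < 1) : artanh x ≤ artanh y := by
  unfold artanh
  have h1 : 0 < 1 - y := by linarith
  have h2 : 0 < 1 - x := by linarith
  have h4 : 0 ≤ 1 + y := by linarith
  have : (1 + x) / (1 - x) ≤ (1 + y) / (1 - y) := by gcongr
  have h3 : 0 < (1 + x) / (1 - x) := by positivity
  have := Real.log_le_log h3 this
  linarith

theorem artanh_nonneg {x : ℝ} (hx : 0 ≤ x) (hx1 : x < 1) : 0 ≤ artanh x :=
  artanh_zero ▸ artanh_mono le_rfl hx hx1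

theorem artanh_half : artanh (1 / 2) = Real.log 3 / 2 := by
  unfold artanh; norm_num

theorem lempert_nonneg {N : ℕ} (Ω : Set (E N)) (z w : E N) : 0 ≤ lempert Ω z w := by
  unfold lempert
  set S := { r : ℝ | ∃ φ : ℂ → E N, DifferentiableOn ℂ φ (ball 0 1) ∧
    MapsTo φ (ball (0:ℂ) 1) Ω ∧ φ 0 = z ∧ ∃ a ∈ ball (0:ℂ) 1, φ a = w ∧ r = ‖a‖ } with hS
  have h0 : ∀ r ∈ S, 0 ≤ r := by
    rintro r ⟨φ, -, -, -, a, -, -, rfl⟩; exact norm_nonneg _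
  rcases S.eq_empty_or_nonempty with h | ⟨r, hr⟩
  · rw [h, Real.sInf_empty, artanh_zero]
  · have hr1 : r < 1 := by
      obtain ⟨φ, -, -, -, a, ha, -, rfl⟩ := hr
      simpa using ha
    exact artanh_nonneg (Real.sInf_nonneg h0) ((csInf_le ⟨0, h0⟩ hr).trans_lt hr1)

theorem lempert_le {N : ℕ} {Ω : Set (E N)} {ψ : ℂ → E N} (hψ : DifferentiableOn ℂ ψ (ball 0 1))
    (hm : MapsTo ψ (ball 0 1) Ω) {a : ℂ} (ha : ‖a‖ < 1) :
    lempert Ω (ψ 0) (ψ a) ≤ artanh ‖a‖ := by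
  unfold lempert
  refine artanh_mono (Real.sInf_nonneg ?_) (csInf_le ⟨0, ?_⟩ ⟨ψ, hψ, hm, rfl, a, by simpa, rfl, rfl⟩) ha
  all_goals rintro r ⟨φ, -, -, -, a, -, -, rfl⟩; exact norm_nonneg _

theorem norm_sub_lt_norm_one_sub {a z : ℂ} (ha : ‖a‖ < 1) (hz : ‖z‖ < 1) :
    ‖a - z‖ < ‖1 - (starRingEnd ℂ) a * z‖ := by
  refine lt_of_pow_lt_pow_left₀ 2 (norm_nonneg _) ?_
  have h1 : Complex.normSq a < 1 := by
    rw [Complex.normSq_eq_norm_sq]; nlinarith [norm_nonneg a]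
  have h2 : Complex.normSq z < 1 := by
    rw [Complex.normSq_eq_norm_sq]; nlinarith [norm_nonneg z]
  rw [← Complex.normSq_eq_norm_sq, ← Complex.normSq_eq_norm_sq]
  rw [Complex.normSq_apply] at h1 h2 ⊢
  rw [Complex.normSq_apply]
  simp
  nlinarith [mul_pos (sub_pos.2 h1) (sub_pos.2 h2)]

theorem lempert_le' {N : ℕ} {Ω : Set (E N)} {ψ : ℂ → E N} (hψ : DifferentiableOn ℂ ψ (ball 0 1))
    (hm : MapsTo ψ (ball 0 1) Ω) {a : ℂ} (ha : ‖a‖ < 1) :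
    lempert Ω (ψ a) (ψ 0) ≤ artanh ‖a‖ := by
  have hne : ∀ z ∈ ball (0 : ℂ) 1, 1 - (starRingEnd ℂ) a * z ≠ 0 := by
    intro z hz h0
    have := norm_sub_lt_norm_one_sub ha (by simpa using hz : ‖z‖ < 1)
    rw [h0, norm_zero] at this
    exact absurd this (norm_nonneg _).not_gt
  have hmap : MapsTo (fun z => (a - z) / (1 - (starRingEnd ℂ) a * z)) (ball 0 1) (ball (0 : ℂ) 1) := by
    intro z hz
    have := norm_sub_lt_norm_one_sub ha (by simpa using hz : ‖z‖ < 1)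
    rw [mem_ball_zero_iff, norm_div, div_lt_one ((norm_nonneg _).trans_lt this)]
    exact this
  have hd : DifferentiableOn ℂ (fun z => (a - z) / (1 - (starRingEnd ℂ) a * z)) (ball 0 1) := by
    apply DifferentiableOn.div _ _ hne <;> fun_prop
  have := lempert_le (hψ.comp hd hmap) (hm.comp hmap) ha
  simpa using this

/-- Chains of analytic discs from one point to another of total length at most the given number,
in both directions. -/
inductive HasChain {N : ℕ} (Ω : Set (E N)) : E N → E N → ℝ → Prop
  | refl {x : E N} {c : ℝ} (hx : x ∈ Ω) (hc : 0 ≤ c) : HasChain Ω x x c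
  | cons {z w u : E N} {a c : ℝ} (hz : z ∈ Ω) (h₁ : lempert Ω z w ≤ a) (h₂ : lempert Ω w z ≤ a)
      (h : HasChain Ω w u c) : HasChain Ω z u (a + c)

variable {N : ℕ} {Ω : Set (E N)} {x y z : E N} {a b : ℝ}

theorem HasChain.mono (h : HasChain Ω x y a) : ∀ {b : ℝ}, a ≤ b → HasChain Ω x y b := by
  induction h with
  | refl hx hc => exact fun h => .refl hx (hc.trans h)
  | @cons z w u a c hz h₁ h₂ h ih =>
    intro b hb
    have := HasChain.cons hz h₁ h₂ (ih (b := b - a) (by linarith))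
    rwa [add_sub_cancel] at this

theorem HasChain.trans (h : HasChain Ω x y a) (h' : HasChain Ω y z b) :
    HasChain Ω x z (a + b) := by
  induction h with
  | refl hx hc => exact h'.mono (by linarith)
  | cons hz h₁ h₂ h ih =>
    rw [add_assoc]
    exact .cons hz h₁ h₂ (ih h')

theorem HasChain.right_mem (h : HasChain Ω x y a) : y ∈ Ω := by
  induction h with
  | refl hx hc => exact hx
  | cons hz h₁ h₂ h ih => exact ih

theorem HasChain.left_mem (h : HasChain Ω x y a) : x ∈ Ω := by
  cases h <;> assumption

theorem HasChain.single (hx : x ∈ Ω) (hy : y ∈ Ω) (h₁ : lempert Ω x y ≤ a)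
    (h₂ : lempert Ω y x ≤ a) : HasChain Ω x y a := by
  have := HasChain.cons hx h₁ h₂ (.refl hy le_rfl)
  rwa [add_zero] at this

theorem HasChain.symm (h : HasChain Ω x y a) : HasChain Ω y x a := by
  induction h with
  | refl hx hc => exact .refl hx hc
  | cons hz h₁ h₂ h ih =>
    rw [add_comm]
    exact ih.trans (.single ih.right_mem hz h₂ h₁)

theorem HasChain.of_disc {ψ : ℂ → E N} (hψ : DifferentiableOn ℂ ψ (ball 0 1))
    (hm : MapsTo ψ (ball 0 1) Ω) {a : ℂ} (ha : ‖a‖ < 1) :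
    HasChain Ω (ψ 0) (ψ a) (artanh ‖a‖) :=
  .single (hm (by simp)) (hm (by simpa)) (lempert_le hψ hm ha) (lempert_le' hψ hm ha)

theorem HasChain.kobayashi_le (h : HasChain Ω x y a) : kobayashi Ω x y ≤ a := by
  have key : ∃ b ≤ a, ∃ (n : ℕ) (p : Fin (n + 1) → E N), p 0 = x ∧ p (Fin.last n) = y ∧
      (∀ i, p i ∈ Ω) ∧ b = ∑ i : Fin n, lempert Ω (p i.castSucc) (p i.succ) := by
    induction h with
    | @refl x c hx hc => exact ⟨0, hc, 0, fun _ => x, rfl, rfl, fun _ => hx, by simp⟩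
    | @cons z w u a c hz h₁ h₂ h ih =>
      obtain ⟨b, hb, n, p, hp0, hpl, hp, rfl⟩ := ih
      refine ⟨_, ?_, n + 1, Fin.cons z p, by simp, ?_, ?_, rfl⟩
      · rw [Fin.sum_univ_succ]
        simp only [Fin.castSucc_zero, Fin.cons_zero, Fin.cons_succ, ← Fin.succ_castSucc]
        rw [hp0]
        linarith
      · rw [← Fin.succ_last, Fin.cons_succ, hpl]
      · intro i
        refine Fin.cases ?_ (fun i => ?_) i
        · simpa using hz
        · simpa using hp i
  obtain ⟨b, hb, hmem⟩ := key
  unfold kobayashi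
  refine (csInf_le (a := b) ⟨0, ?_⟩ ?_).trans hb
  swap
  · exact hmem
  rintro _ ⟨n, p, -, -, -, rfl⟩
  exact Finset.sum_nonneg fun i _ => lempert_nonneg _ _ _

variable {r : E N → ℝ} {D : E N → E N →L[ℂ] ℂ} {η c₀ B : ℝ}

theorem PshData.hasChain_normal (h : PshData Ω r D η c₀ B) {ν : E N} {R B' : ℝ} (hx : x ∈ Ω)
    (hR : -r x ≤ R) (hν : D x ν = -1) (hνB : ‖ν‖ ≤ B') (hB' : 0 < B')
    (h1 : 2 * R * B * B' ^ 2 ≤ 1) (h2 : 3 * R * B' < η) :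
    r (x + (R : ℂ) • ν) ≤ -R / 2 ∧
      HasChain Ω x (x + (R : ℂ) • ν) (Real.log (8 * R / -r x) / 2) := by
  have hd : 0 < -r x := by linarith [h.neg x hx]
  set d := -r x with hdd
  have hR0 : 0 < R := hd.trans_le hR
  have hB : 0 < B := by linarith [h.one_le]
  have est : ∀ c : ℂ, ‖c‖ ≤ 3 * R → ‖x + c • ν - x‖ < η ∧
      r (x + c • ν) ≤ -d + (‖c - R‖ ^ 2 - R ^ 2) / (2 * R) := by
    intro c hc
    have hn : ‖x + c • ν - x‖ ≤ ‖c‖ * B' := by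
      rw [add_sub_cancel_left, norm_smul]; gcongr
    have hlt : ‖x + c • ν - x‖ < η := by
      refine hn.trans_lt (lt_of_le_of_lt ?_ h2); gcongr
    refine ⟨hlt, ?_⟩
    have ht := (abs_le.1 (h.taylor x hx _ hlt)).2
    have e1 : (D x (x + c • ν - x)).re = -c.re := by
      rw [add_sub_cancel_left, map_smul, hν]; simp
    rw [e1] at ht
    have e2 : B * ‖x + c • ν - x‖ ^ 2 ≤ ‖c‖ ^ 2 / (2 * R) := by
      rw [le_div_iff₀ (by positivity)]
      calc B * ‖x + c • ν - x‖ ^ 2 * (2 * R) ≤ B * (‖c‖ * B') ^ 2 * (2 * R) := by gcongr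
        _ = ‖c‖ ^ 2 * (2 * R * B * B' ^ 2) := by ring
        _ ≤ ‖c‖ ^ 2 * 1 := by gcongr
        _ = _ := mul_one _
    have e3 : ‖c - R‖ ^ 2 = ‖c‖ ^ 2 - 2 * R * c.re + R ^ 2 := by
      rw [← Complex.normSq_eq_norm_sq, ← Complex.normSq_eq_norm_sq, Complex.normSq_apply,
        Complex.normSq_apply]
      simp; ring
    rw [e3]
    have e4 : (‖c‖ ^ 2 - 2 * R * c.re + R ^ 2 - R ^ 2) / (2 * R) = ‖c‖ ^ 2 / (2 * R) - c.re := by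
      field_simp; ring
    rw [e4]
    linarith
  have hRn : ‖(R : ℂ)‖ = R := by simp [abs_of_pos hR0]
  constructor
  · have := (est R (by rw [hRn]; linarith)).2
    rw [sub_self, norm_zero] at this
    have e : ((0:ℝ) ^ 2 - R ^ 2) / (2 * R) = -R / 2 := by field_simp; ring
    rw [e] at this
    linarith
  · set R' := √(R ^ 2 + 2 * R * d) with hR'
    have hRsq : R' ^ 2 = R ^ 2 + 2 * R * d := Real.sq_sqrt (by positivity)
    have hRR : R < R' := by
      refine Real.lt_sqrt_of_sq_lt ?_
      have : 0 < 2 * R * d := by positivity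
      linarith
    have hR'2 : R' ≤ 2 * R := by
      refine Real.sqrt_le_iff.2 ⟨by positivity, ?_⟩
      nlinarith
    have hR'0 : 0 < R' := hR0.trans hRR
    have hψ : DifferentiableOn ℂ (fun ζ : ℂ => x + ((R : ℂ) + R' * ζ) • ν) (ball 0 1) := by
      fun_prop
    have hm : MapsTo (fun ζ : ℂ => x + ((R : ℂ) + R' * ζ) • ν) (ball 0 1) Ω := by
      intro ζ hζ
      rw [mem_ball_zero_iff] at hζ
      have hn : ‖(R' : ℂ) * ζ‖ < R' := by
        rw [norm_mul, Complex.norm_real, Real.norm_of_nonneg hR'0.le]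
        nlinarith
      have hc : ‖(R : ℂ) + R' * ζ‖ ≤ 3 * R :=
        (norm_add_le _ _).trans (by rw [hRn]; linarith)
      obtain ⟨g1, g2⟩ := est _ hc
      refine h.mem x hx _ g1 (g2.trans_lt ?_)
      rw [add_sub_cancel_left]
      have : ‖(R' : ℂ) * ζ‖ ^ 2 < R' ^ 2 := by gcongr
      have : (‖(R' : ℂ) * ζ‖ ^ 2 - R ^ 2) / (2 * R) < d := by
        rw [div_lt_iff₀ (by positivity)]; linarith
      linarith
    have hn : ‖(-(R / R') : ℂ)‖ = R / R' := by
      rw [norm_neg, norm_div, hRn, Complex.norm_real, Real.norm_of_nonneg hR'0.le]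
    have hlt : R / R' < 1 := (div_lt_one hR'0).2 hRR
    have := (HasChain.of_disc hψ hm (a := -(R / R')) (by rw [hn]; exact hlt)).symm
    have hR'c : (R' : ℂ) ≠ 0 := by exact_mod_cast hR'0.ne'
    have e : (R : ℂ) + R' * -(R / R') = 0 := by field_simp; ring
    simp only [e, hn, mul_zero, add_zero, zero_smul] at this
    refine this.mono ?_
    unfold artanh
    have h3 : 0 < R' - R := by linarith
    have e1 : (1 + R / R') / (1 - R / R') = (R' + R) ^ 2 / (2 * R * d) := by
      rw [show 2 * R * d = (R' + R) * (R' - R) by linear_combination -hRsq]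
      have : R' + R ≠ 0 := by positivity
      have : 1 - R / R' ≠ 0 := by linarith
      rw [div_eq_div_iff this (by positivity)]
      field_simp
    rw [e1]
    have : (R' + R) ^ 2 / (2 * R * d) ≤ 8 * R / d := by
      rw [div_le_div_iff₀ (by positivity) hd]
      have : (R' + R) ^ 2 ≤ (3 * R) ^ 2 := by gcongr; linarith
      nlinarith
    have := Real.log_le_log (by positivity) this
    linarith

end Kobayashi

section UpperBound

variable {N : ℕ} {Ω : Set (E N)} {r : E N → ℝ} {D : E N → E N →L[ℂ] ℂ} {η c₀ B : ℝ}

theorem PshData.hasChain_of_close (h : PshData Ω r D η c₀ B) {x y : E N} {p q : ℝ} (hx : x ∈ Ω)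
    (hq : ‖y - x‖ ≤ q) (hp : ‖D x (y - x)‖ ≤ p) (hqη : 2 * q < η)
    (hpq : 2 * p + 4 * B * q ^ 2 < -r x) : HasChain Ω x y (Real.log 3 / 2) := by
  have hB : 0 < B := by linarith [h.one_le]
  have hm : MapsTo (fun ζ : ℂ => x + (2 * ζ) • (y - x)) (ball 0 1) Ω := by
    intro ζ hζ
    rw [mem_ball_zero_iff] at hζ
    have hz : ‖2 * ζ‖ ≤ 2 := by
      rw [norm_mul, Complex.norm_ofNat]; linarith
    have hn : ‖(2 * ζ) • (y - x)‖ ≤ 2 * q := by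
      rw [norm_smul]; gcongr
    have hn' : ‖x + (2 * ζ) • (y - x) - x‖ < η := by
      rw [add_sub_cancel_left]; linarith
    refine h.mem x hx _ hn' ?_
    have ht := (abs_le.1 (h.taylor x hx _ hn')).2
    rw [add_sub_cancel_left] at ht
    have e1 : (D x ((2 * ζ) • (y - x))).re ≤ 2 * p := by
      refine (Complex.re_le_norm _).trans ?_
      rw [map_smul, smul_eq_mul, norm_mul]
      gcongr
    have e2 : B * ‖(2 * ζ) • (y - x)‖ ^ 2 ≤ B * (2 * q) ^ 2 := by gcongr
    simp only
    linarith
  have hch := HasChain.of_disc (by fun_prop) hm (a := 1 / 2) (by norm_num)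
  have e : x + (2 * (1 / 2) : ℂ) • (y - x) = y := by norm_num
  have e' : ‖(1 / 2 : ℂ)‖ = 1 / 2 := by norm_num
  simpa only [e, e', mul_zero, zero_smul, add_zero, artanh_half] using hch

theorem PshData.exists_hasChain_near (h : PshData Ω r D η c₀ B) :
    ∃ a₀ M : ℝ, 0 < a₀ ∧ 0 < M ∧ ∀ x ∈ Ω, ∀ y ∈ Ω, ∀ a : ℝ, 0 < a → a ≤ a₀ → ‖y - x‖ ≤ a →
      ‖D x (y - x)‖ ≤ a ^ 2 → -r x ≤ a ^ 2 → -r y ≤ a ^ 2 →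
        HasChain Ω x y (Real.log (M * a ^ 4 / (-r x * -r y)) / 2) := by
  have hB1 := h.one_le
  have hB : 0 < B := by linarith
  have hη := h.eta_pos
  have hc := h.c_pos
  refine ⟨min (1 / (64 * B ^ 3)) (min (η / 8) (c₀ / 2)), 192 * (72 * B) ^ 2, by positivity,
    by positivity, ?_⟩
  intro x hx y hy a ha haa hxy hDxy hdx hdy
  have ha1 : a * (64 * B ^ 3) ≤ 1 := by
    have := haa.trans (min_le_left _ _)
    rwa [le_div_iff₀ (by positivity)] at this
  have ha2 : a ≤ η / 8 := haa.trans ((min_le_right _ _).trans (min_le_left _ _))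
  have ha3 : a ≤ c₀ / 2 := haa.trans ((min_le_right _ _).trans (min_le_right _ _))
  have hB2 : 1 ≤ B ^ 2 := one_le_pow₀ hB1
  have hB3 : B ^ 2 ≤ B ^ 3 := pow_le_pow_right₀ hB1 (by norm_num)
  have haB2 : 64 * (a * B ^ 2) ≤ 1 := by nlinarith
  have haB1 : 64 * (a * B) ≤ 1 := by nlinarith
  have ha4 : 64 * a ≤ 1 := by nlinarith
  have hac : a ^ 2 < c₀ := by nlinarith
  set R := 72 * B * a ^ 2 with hR
  have hR0 : 0 < R := by positivity
  have hRa : a ^ 2 ≤ R := by nlinarith [sq_nonneg a]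
  have haB6 : (a * (64 * B ^ 3)) ^ 2 ≤ 1 := pow_le_one₀ (by positivity) ha1
  have hR3 : 2 * R * B * (2 * B) ^ 2 ≤ 1 := by
    have : 2 * R * B * (2 * B) ^ 2 = 576 * B ^ 4 * a ^ 2 := by rw [hR]; ring
    have h4 : B ^ 4 ≤ B ^ 6 := pow_le_pow_right₀ hB1 (by norm_num)
    nlinarith [sq_nonneg a, mul_le_mul_of_nonneg_right h4 (sq_nonneg a)]
  have hR3' : 2 * R * B ^ 3 ≤ 1 := by
    have : 2 * R * B * (2 * B) ^ 2 = 4 * (2 * R * B ^ 3) := by ring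
    have : 0 < 2 * R * B ^ 3 := by positivity
    linarith
  have hRη : 3 * R * (2 * B) < η := by
    have : 3 * R * (2 * B) = 432 * (a * B ^ 2) * a := by rw [hR]; ring
    rw [this]
    have : 432 * (a * B ^ 2) ≤ 7 := by linarith
    nlinarith
  obtain ⟨ν, hν, hνB⟩ := h.normal x hx (by linarith)
  set t : ℂ := -D y ν with ht
  have ht1 : ‖t - 1‖ ≤ a * B ^ 2 := by
    have e : t - 1 = (D x - D y) ν := by
      rw [sub_apply, hν, ht]; ring
    rw [e]
    calc _ ≤ ‖D x - D y‖ * ‖ν‖ := ContinuousLinearMap.le_opNorm _ _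
      _ ≤ (B * ‖x - y‖) * B := by gcongr; exact h.lip x hx y hy
      _ ≤ (B * a) * B := by gcongr; rwa [norm_sub_rev]
      _ = _ := by ring
  have htn : 1 / 2 ≤ ‖t‖ := by
    have : ‖(1:ℂ)‖ ≤ ‖t‖ + ‖t - 1‖ := by
      simpa using _root_.norm_sub_le t (t - 1)
    rw [norm_one] at this
    linarith
  have ht0 : t ≠ 0 := by
    intro h0; rw [h0, norm_zero] at htn; linarith
  have htinv : ‖t⁻¹‖ ≤ 2 := by
    rw [norm_inv]; exact inv_le_of_inv_le₀ (by norm_num) (by linarith)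
  have htinv1 : ‖t⁻¹ - 1‖ ≤ 2 * (a * B ^ 2) := by
    have e : t⁻¹ - 1 = -(t⁻¹ * (t - 1)) := by field_simp; ring
    rw [e, norm_neg, norm_mul]
    gcongr
  set μ : E N := t⁻¹ • ν with hμ
  have hμD : D y μ = -1 := by
    rw [hμ, map_smul, smul_eq_mul, show D y ν = -t by rw [ht, neg_neg]]
    field_simp
  have hμB : ‖μ‖ ≤ 2 * B := by
    rw [hμ, norm_smul]; gcongr
  obtain ⟨hrx, hcx⟩ := h.hasChain_normal hx (hdx.trans hRa) hν (hνB.trans (by linarith))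
    (by positivity) hR3 hRη
  obtain ⟨hry, hcy⟩ := h.hasChain_normal hy (hdy.trans hRa) hμD hμB (by positivity) hR3 hRη
  set x' := x + (R : ℂ) • ν with hx'
  set y' := y + (R : ℂ) • μ with hy'
  set v := y' - x' with hv
  have hRn : ‖(R : ℂ)‖ = R := by simp [abs_of_pos hR0]
  have hve : v = (y - x) + ((R : ℂ) * (t⁻¹ - 1)) • ν := by
    rw [hv, hx', hy', hμ]; module
  have hvn : ‖v‖ ≤ 2 * a := by
    rw [hve]
    calc _ ≤ ‖y - x‖ + ‖((R : ℂ) * (t⁻¹ - 1)) • ν‖ := norm_add_le _ _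
      _ ≤ a + (R * (2 * (a * B ^ 2))) * B := by
        rw [norm_smul, norm_mul, hRn]; gcongr
      _ = a + a * (2 * R * B ^ 3) := by ring
      _ ≤ a + a * 1 := by gcongr
      _ = _ := by ring
  have hDv : ‖D x v‖ ≤ a ^ 2 + R * (2 * (a * B ^ 2)) := by
    rw [hve, map_add, map_smul, hν]
    refine (norm_add_le _ _).trans ?_
    rw [smul_eq_mul, norm_mul, norm_mul, hRn, norm_neg, norm_one, mul_one]
    gcongr
  have hx'Ω := hcx.right_mem
  have hy'Ω := hcy.right_mem
  have hDv' : ‖D x' v‖ ≤ a ^ 2 + 4 * R * (a * B ^ 2) := by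
    have e : D x' v = D x v + (D x' - D x) v := by simp
    rw [e]
    have : ‖(D x' - D x) v‖ ≤ (B * (R * B)) * (2 * a) := by
      refine (ContinuousLinearMap.le_opNorm _ _).trans ?_
      gcongr
      refine (h.lip _ hx'Ω _ hx).trans ?_
      gcongr
      rw [hx', add_sub_cancel_left, norm_smul, hRn]
      gcongr
    refine (norm_add_le (D x v) ((D x' - D x) v)).trans ?_
    linarith
  have hch : HasChain Ω x' y' (Real.log 3 / 2) := by
    refine h.hasChain_of_close hx'Ω hvn hDv' (by linarith) ?_
    have e3 : a ^ 2 ≤ B * a ^ 2 := le_mul_of_one_le_left (sq_nonneg a) hB1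
    have e4 : R * (64 * (a * B ^ 2)) ≤ R * 1 := by gcongr
    linarith
  refine ((hcx.trans hch).trans hcy.symm).mono (le_of_eq ?_)
  have hdx0 : 0 < -r x := by linarith [h.neg x hx]
  have hdy0 : 0 < -r y := by linarith [h.neg y hy]
  rw [← add_div, ← add_div, ← Real.log_mul (by positivity) (by norm_num),
    ← Real.log_mul (by positivity) (by positivity)]
  congr 2
  rw [hR]
  field_simp
  ring

theorem PshData.exists_hasChain_far (h : PshData Ω r D η c₀ B) :
    ∃ M : ℝ, 0 < M ∧ ∀ x ∈ Ω, ∀ y ∈ Ω,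
        HasChain Ω x y (Real.log (M / (-r x * -r y)) / 2) := by
  have hB1 := h.one_le
  have hB : 0 < B := by linarith
  have hη := h.eta_pos
  have hc := h.c_pos
  rcases Ω.eq_empty_or_nonempty with hΩ | ⟨o, ho⟩
  · exact ⟨1, one_pos, by simp [hΩ]⟩
  set R := min (min 1 (c₀ / 2)) (min (1 / (2 * B ^ 3)) (η / (6 * B))) with hR
  have hR0 : 0 < R := by positivity
  have hR1 : R ≤ 1 := (min_le_left _ _).trans (min_le_left _ _)
  have hR2 : R ≤ c₀ / 2 := (min_le_left _ _).trans (min_le_right _ _)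
  have hR3 : R * (2 * B ^ 3) ≤ 1 := by
    rw [← le_div_iff₀ (by positivity)]
    exact (min_le_right _ _).trans (min_le_left _ _)
  have hR4 : R * (6 * B) ≤ η := by
    rw [← le_div_iff₀ (by positivity)]
    exact (min_le_right _ _).trans (min_le_right _ _)
  set K := {x ∈ Ω | R / 2 ≤ -r x} with hK
  have hKc : IsCompact K := h.compact _ (by positivity)
  have hconn : ∀ x ∈ Ω, ∃ x' ∈ K, HasChain Ω x x' (Real.log (8 / -r x) / 2) := by
    intro x hx
    have hd : 0 < -r x := by linarith [h.neg x hx]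
    rcases le_or_gt R (-r x) with hRx | hRx
    · refine ⟨x, ⟨hx, by linarith⟩, .refl hx ?_⟩
      have : 1 ≤ 8 / -r x := by
        rw [le_div_iff₀ hd]; linarith [h.neg_le_one x hx]
      have := Real.log_nonneg this
      linarith
    · obtain ⟨ν, hν, hνB⟩ := h.normal x hx (by linarith)
      obtain ⟨h1, h2⟩ := h.hasChain_normal hx hRx.le hν hνB hB (by linarith [hR3]) (by nlinarith)
      refine ⟨_, ⟨h2.right_mem, by linarith⟩, h2.mono ?_⟩
      have : 8 * R / -r x ≤ 8 / -r x := by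
        gcongr; linarith
      have := Real.log_le_log (by positivity) this
      linarith
  have hloc : ∃ L : ℝ, ∀ x ∈ K, HasChain Ω x o L := by
    refine hKc.induction_on (p := fun s => ∃ L : ℝ, ∀ x ∈ s, HasChain Ω x o L) ⟨0, by simp⟩
      (fun s t hst ⟨L, hL⟩ => ⟨L, fun x hx => hL x (hst hx)⟩) ?_ ?_
    · rintro s t ⟨L₁, h₁⟩ ⟨L₂, h₂⟩
      refine ⟨max L₁ L₂, ?_⟩
      rintro x (hx | hx)
      · exact (h₁ x hx).mono (le_max_left _ _)
      · exact (h₂ x hx).mono (le_max_right _ _)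
    · intro x hx
      obtain ⟨ε, hε, hball⟩ := Metric.isOpen_iff.1 h.isOpen x hx.1
      refine ⟨_, mem_nhdsWithin_of_mem_nhds (ball_mem_nhds x (half_pos hε)),
        Real.log 3 / 2 + max (lempert Ω x o) (lempert Ω o x), ?_⟩
      intro y hy
      have hy' : ‖y - x‖ < ε / 2 := by rwa [mem_ball, dist_eq_norm] at hy
      have hm : MapsTo (fun ζ : ℂ => x + (2 * ζ) • (y - x)) (ball 0 1) Ω := by
        intro ζ hζ
        rw [mem_ball_zero_iff] at hζ
        apply hball
        rw [mem_ball, dist_eq_norm, add_sub_cancel_left, norm_smul, norm_mul, Complex.norm_ofNat]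
        nlinarith [norm_nonneg (y - x), norm_nonneg ζ]
      have hch := HasChain.of_disc (by fun_prop) hm (a := 1 / 2) (by norm_num)
      have e : x + (2 * (1 / 2) : ℂ) • (y - x) = y := by norm_num
      have e' : ‖(1 / 2 : ℂ)‖ = 1 / 2 := by norm_num
      simp only [e, e', mul_zero, zero_smul, add_zero, artanh_half] at hch
      exact hch.symm.trans (.single hx.1 ho (le_max_left _ _) (le_max_right _ _))
  obtain ⟨L, hL⟩ := hloc
  refine ⟨64 * Real.exp (4 * L), by positivity, ?_⟩
  intro x hx y hy
  obtain ⟨x', hx', hcx⟩ := hconn x hx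
  obtain ⟨y', hy', hcy⟩ := hconn y hy
  have hdx0 : 0 < -r x := by linarith [h.neg x hx]
  have hdy0 : 0 < -r y := by linarith [h.neg y hy]
  refine (((hcx.trans (hL x' hx')).trans (hL y' hy').symm).trans hcy.symm).mono (le_of_eq ?_)
  rw [show 64 * Real.exp (4 * L) / (-r x * -r y) =
    (8 / -r x) * (8 / -r y) * Real.exp (4 * L) by field_simp; norm_num, Real.log_mul (by positivity)
      (by positivity), Real.log_mul (by positivity) (by positivity), Real.log_exp]
  ring

theorem PshData.exists_kobayashi_le (h : PshData Ω r D η c₀ B) :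
    ∃ M : ℝ, 0 < M ∧ ∀ x ∈ Ω, ∀ y ∈ Ω, ∀ a : ℝ, 0 < a → ‖y - x‖ ≤ a →
      ‖D x (y - x)‖ ≤ a ^ 2 → -r x ≤ a ^ 2 → -r y ≤ a ^ 2 →
        kobayashi Ω x y ≤ Real.log (M * a ^ 4 / (-r x * -r y)) / 2 := by
  obtain ⟨a₀, M₁, ha₀, hM₁, h₁⟩ := h.exists_hasChain_near
  obtain ⟨M₂, hM₂, h₂⟩ := h.exists_hasChain_far
  refine ⟨max M₁ (M₂ / a₀ ^ 4), by positivity, ?_⟩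
  intro x hx y hy a ha g1 g2 g3 g4
  have hdx0 : 0 < -r x := by linarith [h.neg x hx]
  have hdy0 : 0 < -r y := by linarith [h.neg y hy]
  rcases le_or_gt a a₀ with haa | haa
  · refine (h₁ x hx y hy a ha haa g1 g2 g3 g4).kobayashi_le.trans ?_
    gcongr
    exact le_max_left _ _
  · refine (h₂ x hx y hy).kobayashi_le.trans ?_
    gcongr
    calc M₂ = M₂ / a₀ ^ 4 * a₀ ^ 4 := by field_simp
      _ ≤ max M₁ (M₂ / a₀ ^ 4) * a ^ 4 := by gcongr; exact le_max_right _ _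

end UpperBound

section Geodesic

variable {N : ℕ} {Ω : Set (E N)} {r : E N → ℝ} {D : E N → E N →L[ℂ] ℂ} {η c₀ B : ℝ}

theorem poincare_zero (ζ : ℂ) : poincare 0 ζ = artanh ‖ζ‖ := by simp [poincare]

theorem IsComplexGeodesic.exists_ne {φ : ℂ → E N} (hφ : IsComplexGeodesic Ω φ) :
    ∃ a ∈ ball (0 : ℂ) 1, φ a ≠ φ 0 := by
  have hmem : (1 / 2 : ℂ) ∈ ball (0 : ℂ) 1 := by
    rw [mem_ball_zero_iff]; norm_num
  refine ⟨1 / 2, hmem, fun he => ?_⟩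
  have h1 := hφ.2.2 0 (by simp) _ hmem
  rw [he, poincare_zero, show ‖(1 / 2 : ℂ)‖ = 1 / 2 by norm_num, artanh_half] at h1
  have h2 := (HasChain.refl (hφ.2.1 (mem_ball_self one_pos)) le_rfl).kobayashi_le
  have h3 := Real.log_pos (by norm_num : (1 : ℝ) < 3)
  linarith

/-- Improvement of a power-type bound for the defining function along geodesics. -/
theorem PshData.exists_geodesic_step (h : PshData Ω r D η c₀ B) {σ : ℝ} (hσ : σ ≠ 0) :
    ∃ K : ℝ, 0 < K ∧ ∀ φ : ℂ → E N, IsComplexGeodesic Ω φ → ∀ H : ℝ, 0 < H →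
      (∀ ξ : ℂ, ‖ξ‖ < 1 → -r (φ ξ) ≤ H * (1 - ‖ξ‖) ^ (2 * σ)) → ∀ ζ : ℂ, ‖ζ‖ < 1 →
        -r (φ ζ) * -r (φ 0) ≤ K * H ^ 2 * (max 1 ((1 - ‖ζ‖) ^ σ)) ^ 4 * (1 - ‖ζ‖) := by
  obtain ⟨C, hC, hdisp⟩ := h.exists_displacement_bound hσ
  obtain ⟨M, hM, hkob⟩ := h.exists_kobayashi_le
  refine ⟨M * C ^ 4, by positivity, ?_⟩
  intro φ hφ H hH hb ζ hζ
  have hζ1 : 0 < 1 - ‖ζ‖ := by linarith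
  have h0 : φ 0 ∈ Ω := hφ.2.1 (mem_ball_self one_pos)
  have hζm : ζ ∈ ball (0 : ℂ) 1 := by simpa
  have h1 : φ ζ ∈ Ω := hφ.2.1 hζm
  have hd0 : 0 < -r (φ 0) := by linarith [h.neg _ h0]
  have hd1 : 0 < -r (φ ζ) := by linarith [h.neg _ h1]
  obtain ⟨e1, e2⟩ := hdisp φ hφ.1 hφ.2.1 H ζ hζ (fun ξ hξ => hb ξ (hξ.trans_lt hζ))
  set m := max 1 ((1 - ‖ζ‖) ^ σ) with hm
  have hm1 : 1 ≤ m := le_max_left _ _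
  have hm2 : (1 - ‖ζ‖) ^ σ ≤ m := le_max_right _ _
  set a := C * √H * m with ha
  have ha0 : 0 < a := by positivity
  have hasq : a ^ 2 = C ^ 2 * H * m ^ 2 := by
    rw [ha, mul_pow, mul_pow, Real.sq_sqrt hH.le]
  have hCH : H * m ^ 2 ≤ a ^ 2 := by
    rw [hasq, mul_assoc]
    exact le_mul_of_one_le_left (by positivity) (one_le_pow₀ hC)
  have g0 : -r (φ 0) ≤ a ^ 2 := by
    have := hb 0 (by simp)
    simp only [norm_zero, sub_zero, Real.one_rpow, mul_one] at this
    refine this.trans (le_trans ?_ hCH)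
    exact le_mul_of_one_le_right hH.le (one_le_pow₀ hm1)
  have g1 : -r (φ ζ) ≤ a ^ 2 := by
    refine (hb ζ hζ).trans (le_trans ?_ hCH)
    rw [mul_comm 2 σ, Real.rpow_mul hζ1.le, Real.rpow_ofNat]
    gcongr
  have hk := hkob _ h0 _ h1 a ha0 e1 e2 g0 g1
  rw [hφ.2.2 0 (mem_ball_self one_pos) ζ hζm, poincare_zero, artanh] at hk
  have hlog := (Real.log_le_log_iff (by positivity) (by positivity)).1
    (by linarith : Real.log ((1 + ‖ζ‖) / (1 - ‖ζ‖)) ≤ Real.log (M * a ^ 4 / (-r (φ 0) * -r (φ ζ))))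
  rw [div_le_div_iff₀ hζ1 (by positivity)] at hlog
  have ha4 : a ^ 4 = C ^ 4 * H ^ 2 * m ^ 4 := by
    rw [show a ^ 4 = (a ^ 2) ^ 2 by ring, hasq]; ring
  rw [ha4] at hlog
  have : 0 ≤ ‖ζ‖ * (-r (φ 0) * -r (φ ζ)) := by positivity
  linarith

theorem PshData.exists_geodesic_bound (h : PshData Ω r D η c₀ B) {A : ℝ} (hA : 1 ≤ A) :
    ∃ K : ℝ, 0 < K ∧ ∀ φ : ℂ → E N, IsComplexGeodesic Ω φ →
      (∀ ξ : ℂ, ‖ξ‖ < 1 → -r (φ ξ) ≤ A * -r (φ 0)) → ∀ ζ : ℂ, ‖ζ‖ < 1 →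
        -r (φ ζ) ≤ K * -r (φ 0) * (1 - ‖ζ‖) := by
  obtain ⟨K₁, hK₁, h₁⟩ := h.exists_geodesic_step (σ := -1 / 8) (by norm_num)
  obtain ⟨K₂, hK₂, h₂⟩ := h.exists_geodesic_step (σ := 1 / 4) (by norm_num)
  have hA0 : 0 < A := by linarith
  refine ⟨K₂ * (K₁ * A ^ 2) ^ 2, by positivity, ?_⟩
  intro φ hφ hb
  have h0 : φ 0 ∈ Ω := hφ.2.1 (mem_ball_self one_pos)
  set d := -r (φ 0) with hd
  have hd0 : 0 < d := by linarith [h.neg _ h0]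
  have s₁ : ∀ ξ : ℂ, ‖ξ‖ < 1 → -r (φ ξ) ≤ K₁ * A ^ 2 * d * (1 - ‖ξ‖) ^ (2 * (1 / 4) : ℝ) := by
    intro ξ hξ
    have hξ1 : 0 < 1 - ‖ξ‖ := by linarith
    have := h₁ φ hφ (A * d) (by positivity) (fun ξ hξ => (hb ξ hξ).trans ?_) ξ hξ
    · have hm : max 1 ((1 - ‖ξ‖) ^ (-1 / 8 : ℝ)) = (1 - ‖ξ‖) ^ (-1 / 8 : ℝ) :=
        max_eq_right (Real.one_le_rpow_of_pos_of_le_one_of_nonpos hξ1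
          (by linarith [norm_nonneg ξ]) (by norm_num))
      have hp : ((1 - ‖ξ‖) ^ (-1 / 8 : ℝ)) ^ 4 * (1 - ‖ξ‖) = (1 - ‖ξ‖) ^ (2 * (1 / 4) : ℝ) := by
        rw [← Real.rpow_mul_natCast hξ1.le]
        nth_rewrite 2 [← Real.rpow_one (1 - ‖ξ‖)]
        rw [← Real.rpow_add hξ1]
        norm_num
      rw [hm, mul_assoc (K₁ * (A * d) ^ 2), hp] at this
      refine le_of_mul_le_mul_right (this.trans (le_of_eq ?_)) hd0
      ring
    · have : 1 ≤ (1 - ‖ξ‖) ^ (2 * (-1 / 8) : ℝ) :=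
        Real.one_le_rpow_of_pos_of_le_one_of_nonpos (by linarith)
          (by linarith [norm_nonneg ξ]) (by norm_num)
      exact le_mul_of_one_le_right (by positivity) this
  intro ζ hζ
  have := h₂ φ hφ _ (by positivity) s₁ ζ hζ
  rw [max_eq_left (Real.rpow_le_one (by linarith) (by linarith [norm_nonneg ζ]) (by norm_num))] at this
  refine le_of_mul_le_mul_right (this.trans (le_of_eq ?_)) hd0
  ring

theorem PshData.exists_bdist_bounds (h : PshData Ω r D η c₀ B) {A : ℝ} (hA : 1 ≤ A)
    (h₁ : ∀ x ∈ Ω, -r x ≤ A * bdist Ω x) (h₂ : ∀ x ∈ Ω, bdist Ω x ≤ A * -r x) :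
    ∃ c C : ℝ, 0 < c ∧ c < C ∧ ∀ φ : ℂ → E N, IsComplexGeodesic Ω φ →
      (∀ ζ ∈ ball (0:ℂ) 1, bdist Ω (φ ζ) ≤ bdist Ω (φ 0)) →
      ∀ ζ ∈ ball (0:ℂ) 1,
        c / (1 - ‖ζ‖) ≤ bdist Ω (φ 0) / bdist Ω (φ ζ) ∧
        bdist Ω (φ 0) / bdist Ω (φ ζ) ≤ C / (1 - ‖ζ‖) := by
  have hA0 : 0 < A := by linarith
  obtain ⟨κ, hκ, hlow⟩ := h.exists_lower_bound
  obtain ⟨K, hK, hup⟩ := h.exists_geodesic_bound (A := A * A) (by nlinarith)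
  refine ⟨1 / (A ^ 2 * K), max (A ^ 2 / κ) (1 / (A ^ 2 * K) + 1), by positivity,
    (lt_add_one _).trans_le (le_max_right _ _), ?_⟩
  intro φ hφ hmax ζ hζ
  have hζ' : ‖ζ‖ < 1 := by simpa using hζ
  have hζ1 : 0 < 1 - ‖ζ‖ := by linarith
  have h0 : φ 0 ∈ Ω := hφ.2.1 (mem_ball_self one_pos)
  have hz : φ ζ ∈ Ω := hφ.2.1 hζ
  have hd0 : 0 < -r (φ 0) := by linarith [h.neg _ h0]
  have hdz : 0 < -r (φ ζ) := by linarith [h.neg _ hz]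
  have hb0 : 0 < bdist Ω (φ 0) := pos_of_mul_pos_right (hd0.trans_le (h₁ _ h0)) hA0.le
  have hbz : 0 < bdist Ω (φ ζ) := pos_of_mul_pos_right (hdz.trans_le (h₁ _ hz)) hA0.le
  have hl := hlow φ hφ.1 hφ.2.1 hφ.exists_ne ζ hζ'
  have hu := hup φ hφ (fun ξ hξ => by
    have hξm : ξ ∈ ball (0 : ℂ) 1 := by simpa
    calc -r (φ ξ) ≤ A * bdist Ω (φ ξ) := h₁ _ (hφ.2.1 hξm)
      _ ≤ A * (A * -r (φ 0)) := by gcongr; exact (hmax ξ hξm).trans (h₂ _ h0)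
      _ = _ := by ring) ζ hζ'
  constructor
  · rw [div_div, div_le_div_iff₀ (by positivity) hbz, one_mul]
    calc bdist Ω (φ ζ) ≤ A * -r (φ ζ) := h₂ _ hz
      _ ≤ A * (K * (A * bdist Ω (φ 0)) * (1 - ‖ζ‖)) := by
        gcongr; exact hu.trans (by gcongr; exact h₁ _ h0)
      _ = _ := by ring
  · have : bdist Ω (φ 0) / bdist Ω (φ ζ) ≤ A ^ 2 / κ / (1 - ‖ζ‖) := by
      rw [div_div, div_le_div_iff₀ hbz (by positivity)]
      calc bdist Ω (φ 0) * (κ * (1 - ‖ζ‖)) ≤ A * -r (φ 0) * (κ * (1 - ‖ζ‖)) := by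
            gcongr; exact h₂ _ h0
        _ = A * (κ * (1 - ‖ζ‖) * -r (φ 0)) := by ring
        _ ≤ A * (A * bdist Ω (φ ζ)) := mul_le_mul_of_nonneg_left (hl.trans (h₁ _ hz)) hA0.le
        _ = _ := by ring
    refine this.trans ?_
    gcongr
    exact le_max_left _ _

end Geodesic

section BoundaryDistance

variable {N : ℕ} {Ω : Set (E N)} {r : E N → ℝ} {D : E N → E N →L[ℂ] ℂ} {η c₀ B : ℝ}

theorem bdist_le_norm_sub {x y : E N} (hx : x ∈ Ω) (hy : y ∉ Ω) : bdist Ω x ≤ ‖y - x‖ := by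
  obtain ⟨p, hpf, hp⟩ := exists_mem_frontier_infDist_compl_eq_dist hx
    (fun h => hy (h ▸ mem_univ y))
  rw [← dist_eq_norm, dist_comm]
  exact (infDist_le_dist_of_mem hpf).trans (hp ▸ infDist_le_dist_of_mem hy)

theorem PshData.bdist_le (h : PshData Ω r D η c₀ B) (hf : (frontier Ω).Nonempty) {x : E N}
    (hx : x ∈ Ω) : bdist Ω x ≤ B := by
  obtain ⟨p, hp⟩ := hf
  refine (infDist_le_dist_of_mem hp).trans ?_
  have hcl : closure Ω ⊆ closedBall x B := closure_minimal (fun y hy => by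
    rw [mem_closedBall, dist_eq_norm]; exact h.diam _ hy _ hx) isClosed_closedBall
  have := hcl (frontier_subset_closure hp)
  rwa [mem_closedBall, dist_comm] at this

theorem PshData.exists_bdist_le (h : PshData Ω r D η c₀ B) (hf : (frontier Ω).Nonempty) :
    ∃ A : ℝ, 1 ≤ A ∧ ∀ x ∈ Ω, bdist Ω x ≤ A * -r x := by
  have hB1 := h.one_le
  have hB : 0 < B := by linarith
  have hη := h.eta_pos
  have hc := h.c_pos
  set c := min c₀ (min (1 / (4 * B ^ 3)) (η / (2 * B))) with hc'
  have hc0 : 0 < c := by positivity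
  have hBc : 0 ≤ B / c := by positivity
  refine ⟨B / c + 2 * B, by linarith, fun x hx => ?_⟩
  have hd : 0 < -r x := by linarith [h.neg x hx]
  rcases lt_or_ge (-r x) c with hxc | hxc
  · have e1 : -r x < c₀ := hxc.trans_le (min_le_left _ _)
    have e2 : -r x * (4 * B ^ 3) ≤ 1 := by
      rw [← le_div_iff₀ (by positivity)]
      exact hxc.le.trans ((min_le_right _ _).trans (min_le_left _ _))
    have e3 : -r x * (2 * B) < η := by
      rw [← lt_div_iff₀ (by positivity)]
      exact hxc.trans_le ((min_le_right _ _).trans (min_le_right _ _))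
    obtain ⟨ν, hν, hνB⟩ := h.normal x hx e1
    set d := -r x with hdd
    set y := x - ((2 * d : ℝ) : ℂ) • ν with hy
    have hyx : y - x = -(((2 * d : ℝ) : ℂ) • ν) := by rw [hy]; abel
    have hn : ‖y - x‖ ≤ d * (2 * B) := by
      rw [hyx, norm_neg, norm_smul, Complex.norm_real, Real.norm_of_nonneg (by positivity)]
      nlinarith
    have ht := (abs_le.1 (h.taylor x hx y (hn.trans_lt e3))).1
    have e4 : (D x (y - x)).re = 2 * d := by
      rw [hyx, map_neg, map_smul, hν]; simp
    rw [e4] at ht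
    have e5 : B * ‖y - x‖ ^ 2 ≤ d := by
      calc B * ‖y - x‖ ^ 2 ≤ B * (d * (2 * B)) ^ 2 := by gcongr
        _ = d * (d * (4 * B ^ 3)) := by ring
        _ ≤ d * 1 := by gcongr
        _ = d := mul_one d
    have hyΩ : y ∉ Ω := fun hmem => by linarith [h.neg y hmem]
    refine (bdist_le_norm_sub hx hyΩ).trans (hn.trans ?_)
    nlinarith
  · refine (h.bdist_le hf hx).trans ?_
    have : B ≤ B / c * -r x := by
      rw [div_mul_eq_mul_div, le_div_iff₀ hc0]; gcongr
    nlinarith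

theorem PshData.exists_le_bdist (h : PshData Ω r D η c₀ B) (hf : (frontier Ω).Nonempty) :
    ∃ A : ℝ, 1 ≤ A ∧ ∀ x ∈ Ω, -r x ≤ A * bdist Ω x := by
  have hB1 := h.one_le
  have hB : 0 < B := by linarith
  have hη := h.eta_pos
  have hη' : 0 ≤ 1 / η := by positivity
  refine ⟨1 / η + B + B ^ 2, by nlinarith, fun x hx => ?_⟩
  have ht0 : 0 ≤ bdist Ω x := infDist_nonneg
  obtain ⟨p, hp, hpx⟩ := isClosed_frontier.exists_infDist_eq_dist hf x
  have hpx' : ‖p - x‖ = bdist Ω x := by rw [← dist_eq_norm, dist_comm, ← hpx]; rfl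
  rcases lt_or_ge (bdist Ω x) η with hlt | hge
  · have hpΩ : p ∉ Ω := by
      rw [h.isOpen.frontier_eq] at hp
      exact hp.2
    have hrp : 0 ≤ r p := by
      by_contra hneg
      exact hpΩ (h.mem x hx p (by rw [hpx']; exact hlt) (not_le.1 hneg))
    have ht := (abs_le.1 (h.taylor x hx p (by rw [hpx']; exact hlt))).2
    have e1 : (D x (p - x)).re ≤ B * bdist Ω x := by
      refine (Complex.re_le_norm _).trans ((ContinuousLinearMap.le_opNorm _ _).trans ?_)
      rw [hpx']
      gcongr
      exact h.norm_le x hx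
    rw [hpx'] at ht
    have e2 : B * bdist Ω x ^ 2 ≤ B ^ 2 * bdist Ω x := by
      have := h.bdist_le hf hx
      nlinarith [mul_nonneg hB.le ht0]
    nlinarith
  · have : 1 ≤ 1 / η * bdist Ω x := by
      rw [div_mul_eq_mul_div, le_div_iff₀ hη]; linarith
    have h3 := h.neg_le_one x hx
    have : 0 ≤ B * bdist Ω x := by positivity
    have : 0 ≤ B ^ 2 * bdist Ω x := by positivity
    linarith

end BoundaryDistance

section Calculus

theorem _root_.IsCompact.exists_pos_forall_le {X : Type*} [TopologicalSpace X] {K : Set X}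
    (hK : IsCompact K) {f g : X → ℝ} (hf : ContinuousOn f K) (hg : ContinuousOn g K)
    (h : ∀ x ∈ K, g x ≤ 0 → 0 < f x) : ∃ c > 0, ∀ x ∈ K, g x < c → c ≤ f x := by
  rcases K.eq_empty_or_nonempty with rfl | hne
  · exact ⟨1, one_pos, by simp⟩
  obtain ⟨p, hp, hmin⟩ := hK.exists_isMinOn hne (hf.sup hg)
  refine ⟨max (f p) (g p), ?_, fun x hx hgx => ?_⟩
  · rcases le_or_gt (g p) 0 with hgp | hgp
    · exact (h p hp hgp).trans_le (le_max_left _ _)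
    · exact hgp.trans_le (le_max_right _ _)
  · have : max (f p) (g p) ≤ max (f x) (g x) := hmin hx
    rcases le_max_iff.1 this with h' | h'
    · exact h'
    · exact absurd hgx h'.not_gt

variable {W : Type*} [NormedAddCommGroup W] [NormedSpace ℝ W]

theorem _root_.ContDiffOn.differentiableAt_fderiv {f : W → ℝ} {U : Set W} (hU : IsOpen U)
    (hf : ContDiffOn ℝ 2 f U) {x : W} (hx : x ∈ U) : DifferentiableAt ℝ (fderiv ℝ f) x :=
  ((hf.contDiffAt (hU.mem_nhds hx)).fderiv_right (m := 1) (by norm_num)).differentiableAt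
    (by norm_num)

theorem _root_.ContDiffOn.continuousAt_fderiv_fderiv {f : W → ℝ} {U : Set W} (hU : IsOpen U)
    (hf : ContDiffOn ℝ 2 f U) {x : W} (hx : x ∈ U) : ContinuousAt (fderiv ℝ (fderiv ℝ f)) x :=
  (((hf.contDiffAt (hU.mem_nhds hx)).fderiv_right (m := 1) (by norm_num)).fderiv_right
    (m := 0) (by norm_num)).continuousAt

/-- Second order Taylor expansion with remainder uniform along a compact set. -/
theorem _root_.ContDiffOn.exists_uniform_taylor {f : W → ℝ} {U K : Set W} (hU : IsOpen U)
    (hf : ContDiffOn ℝ 2 f U) (hK : IsCompact K) (hKU : K ⊆ U) {ε : ℝ} (hε : 0 < ε) :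
    ∃ η > 0, ∀ x ∈ K, ∀ y, ‖y - x‖ < η → y ∈ U ∧
      ‖fderiv ℝ f y - fderiv ℝ f x - fderiv ℝ (fderiv ℝ f) x (y - x)‖ ≤ ε * ‖y - x‖ ∧
      |f y - f x - fderiv ℝ f x (y - x) - fderiv ℝ (fderiv ℝ f) x (y - x) (y - x) / 2| ≤
        ε * ‖y - x‖ ^ 2 := by
  obtain ⟨δ₁, hδ₁, hthick⟩ := hK.exists_cthickening_subset_open hU hKU
  have hmem : {p : (W →L[ℝ] W →L[ℝ] ℝ) × (W →L[ℝ] W →L[ℝ] ℝ) | dist p.1 p.2 < ε} ∈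
      uniformity (W →L[ℝ] W →L[ℝ] ℝ) :=
    Metric.dist_mem_uniformity (α := W →L[ℝ] W →L[ℝ] ℝ) hε
  obtain ⟨δ₂, hδ₂, huc⟩ := Metric.mem_uniformity_dist.1
    (hK.uniformContinuousAt_of_continuousAt (fderiv ℝ (fderiv ℝ f))
      (fun x hx => hf.continuousAt_fderiv_fderiv hU (hKU hx)) hmem)
  refine ⟨min δ₁ δ₂, lt_min hδ₁ hδ₂, fun x hx y hy => ?_⟩
  have hy₁ : ‖y - x‖ < δ₁ := hy.trans_le (min_le_left _ _)
  have hy₂ : ‖y - x‖ < δ₂ := hy.trans_le (min_le_right _ _)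
  set s := closedBall x ‖y - x‖ with hs
  have hsc : Convex ℝ s := convex_closedBall _ _
  have hxs : x ∈ s := mem_closedBall_self (norm_nonneg _)
  have hys : y ∈ s := by rw [hs, mem_closedBall, dist_eq_norm]
  have hsU : ∀ z ∈ s, z ∈ U := fun z hz => hthick
    (mem_cthickening_of_dist_le z x δ₁ K hx ((mem_closedBall.1 hz).trans hy₁.le))
  have hs₂ : ∀ z ∈ s, ‖fderiv ℝ (fderiv ℝ f) z - fderiv ℝ (fderiv ℝ f) x‖ ≤ ε := by
    intro z hz
    have := huc (a := x) (b := z) (by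
      rw [dist_comm]; exact (mem_closedBall.1 hz).trans_lt hy₂) hx
    have h' : dist (fderiv ℝ (fderiv ℝ f) x) (fderiv ℝ (fderiv ℝ f) z) < ε := this
    rw [dist_comm, dist_eq_norm (E := W →L[ℝ] W →L[ℝ] ℝ)] at h'
    exact h'.le
  have h₁ : ∀ z ∈ s,
      ‖fderiv ℝ f z - fderiv ℝ f x - fderiv ℝ (fderiv ℝ f) x (z - x)‖ ≤ ε * ‖z - x‖ :=
    fun z hz => hsc.norm_image_sub_le_of_norm_hasFDerivWithin_le'
      (fun w hw => (hf.differentiableAt_fderiv hU (hsU w hw)).hasFDerivAt.hasFDerivWithinAt)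
      hs₂ hxs hz
  refine ⟨hsU y hys, h₁ y hys, ?_⟩
  set Q := fderiv ℝ (fderiv ℝ f) x with hQ
  have hsymm : ∀ v w, Q v w = Q w v :=
    (hf.contDiffAt (hU.mem_nhds (hKU hx))).isSymmSndFDerivAt (by simp)
  have hder : ∀ z ∈ s, HasFDerivWithinAt (fun z => f z - 2⁻¹ * Q (z - x) (z - x))
      (fderiv ℝ f z - Q (z - x)) s z := by
    intro z hz
    have hfz : HasFDerivAt f (fderiv ℝ f z) z :=
      ((hf.contDiffAt (hU.mem_nhds (hsU z hz))).differentiableAt (by norm_num)).hasFDerivAt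
    have hid : HasFDerivAt (fun z => z - x) (ContinuousLinearMap.id ℝ W) z :=
      (hasFDerivAt_id z).sub_const x
    have hq := ((Q.hasFDerivAt.comp z hid).clm_apply hid).const_mul (2⁻¹ : ℝ)
    refine ((hfz.sub hq).congr_fderiv ?_).hasFDerivWithinAt
    ext v
    simp
    rw [hsymm v z, hsymm v x]
    ring
  have := hsc.norm_image_sub_le_of_norm_hasFDerivWithin_le' (φ := fderiv ℝ f x) (C := ε * ‖y - x‖)
    hder (fun z hz => by
      have h2 : ‖z - x‖ ≤ ‖y - x‖ := by
        rw [← dist_eq_norm]; exact mem_closedBall.1 hz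
      rw [sub_right_comm]
      exact (h₁ z hz).trans (by gcongr)) hxs hys
  rw [Real.norm_eq_abs] at this
  simp only [sub_self, map_zero, mul_zero, sub_zero] at this
  rw [pow_two, ← mul_assoc]
  convert this using 2
  ring

end Calculus

section DefiningFunction

variable {W : Type*} [NormedAddCommGroup W] [NormedSpace ℝ W]

theorem fderiv_exp_mul_sub_one {f : W → ℝ} {U : Set W} (hU : IsOpen U)
    (hf : ContDiffOn ℝ 2 f U) (A : ℝ) {x : W} (hx : x ∈ U) :
    fderiv ℝ (fun x => Real.exp (A * f x) - 1) x = (A * Real.exp (A * f x)) • fderiv ℝ f x := by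
  have hfx : HasFDerivAt f (fderiv ℝ f x) x :=
    ((hf.contDiffAt (hU.mem_nhds hx)).differentiableAt (by norm_num)).hasFDerivAt
  refine (((hfx.const_mul A).exp).sub_const 1).fderiv.trans ?_
  rw [smul_smul, mul_comm]

theorem fderiv_fderiv_exp_mul_sub_one {f : W → ℝ} {U : Set W} (hU : IsOpen U)
    (hf : ContDiffOn ℝ 2 f U) (A : ℝ) {x : W} (hx : x ∈ U) (v : W) :
    fderiv ℝ (fderiv ℝ (fun x => Real.exp (A * f x) - 1)) x v v =
      A * Real.exp (A * f x) * (fderiv ℝ (fderiv ℝ f) x v v + A * fderiv ℝ f x v ^ 2) := by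
  have hfx : HasFDerivAt f (fderiv ℝ f x) x :=
    ((hf.contDiffAt (hU.mem_nhds hx)).differentiableAt (by norm_num)).hasFDerivAt
  have heq : fderiv ℝ (fun x => Real.exp (A * f x) - 1) =ᶠ[𝓝 x]
      fun x => (A * Real.exp (A * f x)) • fderiv ℝ f x := by
    filter_upwards [hU.mem_nhds hx] with y hy using fderiv_exp_mul_sub_one hU hf A hy
  have := (((hfx.const_mul A).exp).const_mul A).smul
    (hf.differentiableAt_fderiv hU hx).hasFDerivAt
  rw [heq.fderiv_eq, HasFDerivAt.fderiv (f := fun x => (A * Real.exp (A * f x)) • fderiv ℝ f x) this]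
  simp
  ring

variable {N : ℕ}

theorem levi_eq_fderiv (f : E N → ℝ) (p v : E N) :
    levi f p v = (fderiv ℝ (fderiv ℝ f) p v v +
      fderiv ℝ (fderiv ℝ f) p (Complex.I • v) (Complex.I • v)) / 4 := by
  simp [levi, iteratedFDeriv_two_apply]

theorem levi_exp_mul_sub_one {f : E N → ℝ} {U : Set (E N)} (hU : IsOpen U)
    (hf : ContDiffOn ℝ 2 f U) (A : ℝ) {x : E N} (hx : x ∈ U) (v : E N) :
    levi (fun x => Real.exp (A * f x) - 1) x v = A * Real.exp (A * f x) *
      (levi f x v + A * (fderiv ℝ f x v ^ 2 + fderiv ℝ f x (Complex.I • v) ^ 2) / 4) := by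
  simp only [levi_eq_fderiv, fderiv_fderiv_exp_mul_sub_one hU hf A hx]
  ring

theorem continuousOn_levi {f : E N → ℝ} {U : Set (E N)} (hU : IsOpen U)
    (hf : ContDiffOn ℝ 2 f U) : ContinuousOn (fun q : E N × E N => levi f q.1 q.2) (U ×ˢ univ) := by
  have h₂ : ContinuousOn (fun q : E N × E N => fderiv ℝ (fderiv ℝ f) q.1) (U ×ˢ univ) := by
    have : ContinuousOn (fderiv ℝ (fderiv ℝ f)) U :=
      fun x hx => (hf.continuousAt_fderiv_fderiv hU hx).continuousWithinAt
    exact this.comp continuousOn_fst fun q hq => hq.1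
  simp only [levi_eq_fderiv]
  have hs : ContinuousOn (fun q : E N × E N => q.2) (U ×ˢ univ) := continuousOn_snd
  have hI : ContinuousOn (fun q : E N × E N => Complex.I • q.2) (U ×ˢ univ) := by
    fun_prop
  exact (((h₂.clm_apply hs).clm_apply hs).add ((h₂.clm_apply hI).clm_apply hI)).div_const 4

/-- A bounded strongly pseudoconvex domain has a defining function whose Levi form is positive
definite in every direction at boundary points. -/
theorem IsStronglyPseudoconvexDomain.exists_levi_pos {α : ℝ} {Ω : Set (E N)}
    (hΩ : IsStronglyPseudoconvexDomain 2 α Ω) :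
    ∃ (U : Set (E N)) (r : E N → ℝ), IsOpen U ∧ closure Ω ⊆ U ∧ ContDiffOn ℝ 2 r U ∧
      Ω = {x ∈ U | r x < 0} ∧ (∀ x, -r x ≤ 1) ∧ (∀ p ∈ frontier Ω, fderiv ℝ r p ≠ 0) ∧
      ∀ p ∈ frontier Ω, ∀ v : E N, ‖v‖ = 1 → 0 < levi r p v := by
  obtain ⟨-, -, hbd, U, ρ, hU, hcl, ⟨hρ, -⟩, hΩρ, hd, hlevi⟩ := hΩ
  replace hρ : ContDiffOn ℝ 2 ρ U := by exact_mod_cast hρ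
  have hFU : frontier Ω ⊆ U := frontier_subset_closure.trans hcl
  have hF : IsCompact (frontier Ω) :=
    Metric.isCompact_of_isClosed_isBounded isClosed_frontier
      (hbd.closure.subset frontier_subset_closure)
  have hK : IsCompact (frontier Ω ×ˢ sphere (0 : E N) 1) := hF.prod (isCompact_sphere _ _)
  have hKU : frontier Ω ×ˢ sphere (0 : E N) 1 ⊆ U ×ˢ univ := prod_mono hFU (subset_univ _)
  have hl := (continuousOn_levi hU hρ).mono hKU
  have hg : ContinuousOn (fun q : E N × E N =>
      fderiv ℝ ρ q.1 q.2 ^ 2 + fderiv ℝ ρ q.1 (Complex.I • q.2) ^ 2)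
      (frontier Ω ×ˢ sphere (0 : E N) 1) := by
    have h₁ : ContinuousOn (fun q : E N × E N => fderiv ℝ ρ q.1) (U ×ˢ univ) := by
      have : ContinuousOn (fderiv ℝ ρ) U := hρ.continuousOn_fderiv_of_isOpen hU (by norm_num)
      exact this.comp continuousOn_fst fun q hq => hq.1
    exact ((((h₁.clm_apply continuousOn_snd)).pow 2).add
      ((h₁.clm_apply (continuousOn_snd.const_smul Complex.I)).pow 2)).mono hKU
  obtain ⟨c, hc, hc'⟩ := hK.exists_pos_forall_le hl hg (by
    rintro ⟨p, v⟩ ⟨hp, hv⟩ h0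
    have hv1 : v ≠ 0 := by
      rintro rfl
      simp at hv
    dsimp only at h0 hp
    have h1 := sq_nonneg (fderiv ℝ ρ p v)
    have h2 := sq_nonneg (fderiv ℝ ρ p (Complex.I • v))
    exact hlevi p hp v hv1 (pow_eq_zero_iff two_ne_zero |>.1 (by linarith))
      (pow_eq_zero_iff two_ne_zero |>.1 (by linarith)))
  obtain ⟨G, hG⟩ := hK.exists_bound_of_continuousOn hl
  set A : ℝ := 4 * (|G| + 1) / c with hA
  have hA0 : 0 < A := by positivity
  refine ⟨U, fun x => Real.exp (A * ρ x) - 1, hU, hcl, ?_, ?_, ?_, ?_, ?_⟩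
  · exact ((contDiffOn_const.mul hρ).exp).sub contDiffOn_const
  · conv_lhs => rw [hΩρ]
    ext x
    simp only [mem_ofPred_eq, sub_neg, Real.exp_lt_one_iff]
    refine and_congr_right fun _ => ⟨fun h => by nlinarith, fun h => by nlinarith⟩
  · intro x
    have := Real.exp_pos (A * ρ x)
    linarith
  · intro p hp
    rw [fderiv_exp_mul_sub_one hU hρ A (hFU hp)]
    exact smul_ne_zero (by positivity) (hd p hp)
  · intro p hp v hv
    rw [levi_exp_mul_sub_one hU hρ A (hFU hp)]
    have hq : (p, v) ∈ frontier Ω ×ˢ sphere (0 : E N) 1 := ⟨hp, by simpa using hv⟩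
    refine mul_pos (by positivity) ?_
    have hgn : 0 ≤ fderiv ℝ ρ p v ^ 2 + fderiv ℝ ρ p (Complex.I • v) ^ 2 := by positivity
    rcases lt_or_ge (fderiv ℝ ρ p v ^ 2 + fderiv ℝ ρ p (Complex.I • v) ^ 2) c with h | h
    · have := hc' _ hq h
      dsimp only at this
      have : 0 ≤ A * (fderiv ℝ ρ p v ^ 2 + fderiv ℝ ρ p (Complex.I • v) ^ 2) / 4 := by positivity
      linarith
    · have h1 : A * c / 4 ≤ A * (fderiv ℝ ρ p v ^ 2 + fderiv ℝ ρ p (Complex.I • v) ^ 2) / 4 := by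
        gcongr
      have h2 : A * c / 4 = |G| + 1 := by rw [hA]; field_simp
      have h3 := (abs_le.1 ((hG _ hq).trans (le_abs_self G))).1
      dsimp only at h3
      linarith

end DefiningFunction

section Data

variable {N : ℕ}

/-- A real linear form plus the `(2,0)` part of a real quadratic form is the real part of a
holomorphic quadratic polynomial. -/
theorem exists_holomorphic_quadratic (L : E N →L[ℝ] ℝ) (Q : E N →L[ℝ] E N →L[ℝ] ℝ) (x : E N) :
    ∃ P : E N → ℂ, Differentiable ℂ P ∧ P x = 0 ∧
      HasFDerivAt P (StrongDual.extendRCLike L : E N →L[ℂ] ℂ) x ∧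
      ∀ y, (P y).re = L (y - x) +
        (Q (y - x) (y - x) - Q (Complex.I • (y - x)) (Complex.I • (y - x))) / 4 := by
  set e : (E N →L[ℝ] ℝ) ≃ₗ[ℝ] (E N →L[ℂ] ℂ) := StrongDual.extendRCLikeₗ with he
  set τ : E N →ₗ[ℝ] (E N →L[ℂ] ℂ) := e.toLinearMap ∘ₗ Q.toLinearMap with hτ
  have hτ_apply (v w : E N) : τ v w = Q v w - Complex.I * Q v (Complex.I • w) := rfl
  let T : E N →ₗ[ℂ] (E N →L[ℂ] ℂ) :=
    { toFun := fun v => τ v - Complex.I • τ (Complex.I • v)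
      map_add' := fun v w => by
        simp only [smul_add, map_add]
        abel
      map_smul' := fun c v => by
        have hI (u : E N) : Complex.I • Complex.I • u = -u := by
          rw [smul_smul, Complex.I_mul_I, neg_one_smul]
        have h (u : E N) : c • u = c.re • u + c.im • (Complex.I • u) := by
          conv_lhs => rw [← Complex.re_add_im c]
          rw [add_smul, mul_smul]
          simp only [Complex.coe_smul]
        have h' (u : E N →L[ℂ] ℂ) : c • u = c.re • u + c.im • (Complex.I • u) := by
          ext w
          simp only [add_apply, smul_apply, smul_eq_mul, Complex.real_smul]
          conv_lhs => rw [← Complex.re_add_im c]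
          ring
        have h2 : Complex.I • c • v = c.re • (Complex.I • v) - c.im • v := by
          rw [smul_comm, h, hI, smul_neg, sub_eq_add_neg]
        rw [h2, h v, map_add, map_sub, τ.map_smul c.re v, τ.map_smul c.im (Complex.I • v),
          τ.map_smul c.re (Complex.I • v), τ.map_smul c.im v, RingHom.id_apply, h']
        ext w
        simp only [sub_apply, add_apply,
          smul_apply, smul_eq_mul, Complex.real_smul]
        linear_combination (c.im * τ (Complex.I • v) w) * Complex.I_mul_I }
  let S : E N →L[ℂ] E N →L[ℂ] ℂ := LinearMap.toContinuousLinearMap T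
  have hS (v : E N) : (S v v).re = Q v v - Q (Complex.I • v) (Complex.I • v) := by
    change (τ v v - Complex.I * τ (Complex.I • v) v).re = _
    simp [hτ_apply]
  have hid (y : E N) : HasFDerivAt (fun y => y - x) (ContinuousLinearMap.id ℂ (E N)) y :=
    (hasFDerivAt_id y).sub_const x
  have hder (y : E N) := (((StrongDual.extendRCLike L : E N →L[ℂ] ℂ).hasFDerivAt.comp y (hid y)).add
    (((S.hasFDerivAt.comp y (hid y)).clm_apply (hid y)).const_mul (4⁻¹ : ℂ)))
  refine ⟨fun y => (StrongDual.extendRCLike L : E N →L[ℂ] ℂ) (y - x) + 4⁻¹ * S (y - x) (y - x),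
    fun y => (hder y).differentiableAt, by simp, (hder x).congr_fderiv ?_, fun y => ?_⟩
  · ext v
    simp
  · have h4 : (4⁻¹ : ℂ) = ((4⁻¹ : ℝ) : ℂ) := by norm_num
    have h1 : ((StrongDual.extendRCLike L : E N →L[ℂ] ℂ) (y - x)).re = L (y - x) :=
      StrongDual.re_extendRCLike_apply (𝕜 := ℂ) L (y - x)
    rw [Complex.add_re, h1, h4, Complex.re_ofReal_mul, hS]
    ring

theorem exists_apply_eq_neg_one {D : E N →L[ℂ] ℂ} {b : ℝ} (hb : 0 < b) (hD : b ≤ ‖D‖) :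
    ∃ ν, D ν = -1 ∧ ‖ν‖ ≤ 2 / b := by
  obtain ⟨v, hv⟩ : ∃ v, b / 2 * ‖v‖ < ‖D v‖ := by
    by_contra! h
    have := D.opNorm_le_bound (by positivity) h
    linarith
  have hDv : 0 < ‖D v‖ := (by positivity : (0 : ℝ) ≤ b / 2 * ‖v‖).trans_lt hv
  have hDv' : D v ≠ 0 := norm_pos_iff.1 hDv
  refine ⟨-(D v)⁻¹ • v, by simp [hDv'], ?_⟩
  rw [norm_smul, norm_neg, norm_inv, inv_mul_le_iff₀ hDv]
  have : 2 / b * (b / 2 * ‖v‖) = ‖v‖ := by field_simp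
  have h2 : 2 / b * (b / 2 * ‖v‖) ≤ 2 / b * ‖D v‖ := by gcongr
  linarith

theorem IsStronglyPseudoconvexDomain.exists_pshData {α : ℝ} {Ω : Set (E N)}
    (hΩ : IsStronglyPseudoconvexDomain 2 α Ω) :
    ∃ (r : E N → ℝ) (D : E N → E N →L[ℂ] ℂ) (η c₀ B : ℝ), PshData Ω r D η c₀ B := by
  obtain ⟨U, r, hU, hcl, hr, hΩr, hr1, hd, hlevi⟩ := hΩ.exists_levi_pos
  obtain ⟨hopen, -, hbd, -⟩ := hΩ
  have hK : IsCompact (closure Ω) := hbd.isCompact_closure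
  have hbdry : ∀ x ∈ closure Ω, -r x ≤ 0 → x ∈ frontier Ω := fun x hx h => by
    rw [hopen.frontier_eq]
    refine ⟨hx, fun hxΩ => ?_⟩
    rw [hΩr] at hxΩ
    linarith [hxΩ.2]
  have hrc : ContinuousOn r (closure Ω) := hr.continuousOn.mono hcl
  have hd1 : ContinuousOn (fderiv ℝ r) (closure Ω) :=
    (hr.continuousOn_fderiv_of_isOpen hU (by norm_num)).mono hcl
  have hd2 : ContinuousOn (fderiv ℝ (fderiv ℝ r)) (closure Ω) :=
    fun x hx => (hr.continuousAt_fderiv_fderiv hU (hcl hx)).continuousWithinAt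
  have hKS : closure Ω ×ˢ sphere (0 : E N) 1 ⊆ U ×ˢ univ := prod_mono hcl (subset_univ _)
  obtain ⟨m, hm, hm'⟩ := (hK.prod (isCompact_sphere (0 : E N) 1)).exists_pos_forall_le
    ((continuousOn_levi hU hr).mono hKS)
    (g := fun q => -r q.1) (hrc.neg.comp continuousOn_fst fun q hq => hq.1)
    (fun q hq h => hlevi _ (hbdry _ hq.1 h) _ (by simpa using hq.2))
  obtain ⟨b, hb, hb'⟩ := hK.exists_pos_forall_le hd1.norm hrc.neg
    (fun x hx h => norm_pos_iff.2 (hd x (hbdry x hx h)))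
  have hlev : ∀ x ∈ Ω, -r x < m → ∀ v, m * ‖v‖ ^ 2 ≤ levi r x v := by
    intro x hx hxm v
    rcases eq_or_ne v 0 with rfl | hv
    · simp [levi_eq_fderiv]
    have hv0 : ‖v‖ ≠ 0 := norm_ne_zero_iff.2 hv
    have h1 : m ≤ levi r x (‖v‖⁻¹ • v) :=
      hm' (x, ‖v‖⁻¹ • v) ⟨subset_closure hx, by simp [norm_smul, hv0]⟩ hxm
    have h2 : levi r x (‖v‖⁻¹ • v) = levi r x v / ‖v‖ ^ 2 := by
      simp only [levi_eq_fderiv, smul_comm Complex.I (‖v‖⁻¹), map_smul,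
        smul_apply, smul_eq_mul]
      field_simp
    rw [h2, le_div_iff₀ (by positivity)] at h1
    exact h1
  obtain ⟨η, hη, htay⟩ := hr.exists_uniform_taylor hU hK hcl (half_pos hm)
  obtain ⟨B₁, hB₁⟩ := hK.exists_bound_of_continuousOn hd1
  obtain ⟨B₂, hB₂⟩ := hK.exists_bound_of_continuousOn
    (E := E N →L[ℝ] E N →L[ℝ] ℝ) hd2
  obtain ⟨B₃, hB₃⟩ := Metric.isBounded_iff.1 hbd
  have hnorm (L : E N →L[ℝ] ℝ) : ‖(StrongDual.extendRCLike L : E N →L[ℂ] ℂ)‖ = ‖L‖ :=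
    StrongDual.norm_extendRCLike L
  set B := max 1 (max |B₁| (max (m / 2 + |B₂|) (max (2 * |B₁| / η) (max (2 / b) (max (2 / m) B₃)))))
    with hB
  have hB1 : 1 ≤ B := le_max_left _ _
  have hBB₁ : |B₁| ≤ B := by simp [hB]
  have hBB₂ : m / 2 + |B₂| ≤ B := by simp [hB]
  have hBη : 2 * |B₁| / η ≤ B := by simp [hB]
  have hBb : 2 / b ≤ B := by simp [hB]
  have hBm : 2 / m ≤ B := by simp [hB]
  have hBB₃ : B₃ ≤ B := by simp [hB]
  have hre (x v : E N) : ((StrongDual.extendRCLike (fderiv ℝ r x) : E N →L[ℂ] ℂ) v).re =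
      fderiv ℝ r x v := StrongDual.re_extendRCLike_apply (𝕜 := ℂ) _ v
  have hb1 : ∀ x ∈ Ω, ‖fderiv ℝ r x‖ ≤ |B₁| :=
    fun x hx => (hB₁ x (subset_closure hx)).trans (le_abs_self _)
  have hb2 : ∀ x ∈ Ω, ∀ v, ‖fderiv ℝ (fderiv ℝ r) x v‖ ≤ |B₂| * ‖v‖ := fun x hx v =>
    ContinuousLinearMap.le_of_opNorm_le _
      ((hB₂ x (subset_closure hx)).trans (le_abs_self _)) v
  refine ⟨r, fun x => StrongDual.extendRCLike (fderiv ℝ r x), η, min m b, B, ?_⟩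
  exact {
    eta_pos := hη
    c_pos := lt_min hm hb
    one_le := hB1
    isOpen := hopen
    neg := fun x hx => by
      rw [hΩr] at hx
      exact hx.2
    neg_le_one := fun x _ => hr1 x
    mem := fun x hx y hy hry => by
      rw [hΩr]
      exact ⟨(htay x (subset_closure hx) y hy).1, hry⟩
    taylor := fun x hx y hy => by
      obtain ⟨-, -, h⟩ := htay x (subset_closure hx) y hy
      rw [hre]
      have h2 : |fderiv ℝ (fderiv ℝ r) x (y - x) (y - x)| ≤ |B₂| * ‖y - x‖ * ‖y - x‖ :=
        ContinuousLinearMap.le_of_opNorm_le _ (hb2 x hx _) _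
      have h3 : (m / 2 + |B₂|) * ‖y - x‖ ^ 2 ≤ B * ‖y - x‖ ^ 2 := by gcongr
      have h4 : 0 ≤ |B₂| * ‖y - x‖ ^ 2 := by positivity
      rw [abs_le] at h h2 ⊢
      constructor <;> nlinarith
    norm_le := fun x hx => by
      rw [hnorm]
      exact (hb1 x hx).trans hBB₁
    lip := fun x hx y hy => by
      have hsub : (StrongDual.extendRCLike (fderiv ℝ r x) : E N →L[ℂ] ℂ) -
          StrongDual.extendRCLike (fderiv ℝ r y) =
          StrongDual.extendRCLike (fderiv ℝ r x - fderiv ℝ r y) :=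
        (map_sub (StrongDual.extendRCLikeₗ (𝕜 := ℂ) (F := E N)) _ _).symm
      rw [hsub, hnorm]
      rcases lt_or_ge ‖x - y‖ η with h | h
      · obtain ⟨-, h1, -⟩ := htay y (subset_closure hy) x h
        have h2 := norm_le_norm_sub_add (fderiv ℝ r x - fderiv ℝ r y)
          (fderiv ℝ (fderiv ℝ r) y (x - y))
        have h3 := hb2 y hy (x - y)
        have h4 : (m / 2 + |B₂|) * ‖x - y‖ ≤ B * ‖x - y‖ := by gcongr
        linarith
      · have h1 := norm_sub_le (fderiv ℝ r x) (fderiv ℝ r y)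
        have h2 := hb1 x hx
        have h3 := hb1 y hy
        have h4 : 2 * |B₁| / η * η ≤ B * ‖x - y‖ := by gcongr
        rw [div_mul_cancel₀ _ hη.ne'] at h4
        linarith
    normal := fun x hx h => by
      obtain ⟨ν, hν, hν'⟩ := exists_apply_eq_neg_one hb (D := StrongDual.extendRCLike (fderiv ℝ r x))
        (by
          rw [hnorm]
          exact hb' x (subset_closure hx) (h.trans_le (min_le_right _ _)))
      exact ⟨ν, hν, hν'.trans hBb⟩
    support := fun x hx h => by
      obtain ⟨P, hP, hPx, hPD, hPre⟩ :=
        exists_holomorphic_quadratic (fderiv ℝ r x) (fderiv ℝ (fderiv ℝ r) x) x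
      refine ⟨P, hP, hPx, hPD, fun y hy => ?_⟩
      obtain ⟨-, -, h1⟩ := htay x (subset_closure hx) y hy
      have h2 := hlev x hx (h.trans_le (min_le_left _ _)) (y - x)
      rw [levi_eq_fderiv] at h2
      rw [hPre]
      have h3 : 1 / B ≤ m / 2 := by
        rw [div_le_iff₀ hm] at hBm
        rw [div_le_iff₀ (by linarith)]
        linarith
      have h4 : ‖y - x‖ ^ 2 / B ≤ m / 2 * ‖y - x‖ ^ 2 := by
        rw [div_eq_mul_one_div, mul_comm]
        gcongr
      have h5 := (abs_le.1 h1).1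
      linarith
    diam := fun x hx y hy => by
      rw [← dist_eq_norm]
      exact (hB₃ hx hy).trans hBB₃
    compact := fun c hc => by
      have heq : {x ∈ Ω | c ≤ -r x} = closure Ω ∩ r ⁻¹' Iic (-c) := by
        ext x
        refine ⟨fun hx => ⟨subset_closure hx.1, by have := hx.2; simp; linarith⟩, fun hx => ?_⟩
        have h1 : r x ≤ -c := hx.2
        refine ⟨?_, by linarith⟩
        rw [hΩr]
        exact ⟨hcl hx.1, by linarith⟩
      rw [heq]
      exact hK.of_isClosed_subset (hrc.preimage_isClosed_of_isClosed isClosed_closure isClosed_Iic)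
        inter_subset_left
    continuousOn := hrc.mono subset_closure }

end Data

/-- Boundary distance along a complex geodesic compared with the
boundary distance of the unit disc. -/
theorem stmt14 {N : ℕ} {α : ℝ} (hα : α ∈ Set.Ioc (0:ℝ) 1)
    (Ω : Set (E N)) (hΩ : IsStronglyPseudoconvexDomain 2 α Ω) :
    ∃ c C : ℝ, 0 < c ∧ c < C ∧ ∀ φ : ℂ → E N, IsComplexGeodesic Ω φ →
      (∀ ζ ∈ ball (0:ℂ) 1, bdist Ω (φ ζ) ≤ bdist Ω (φ 0)) →
      ∀ ζ ∈ ball (0:ℂ) 1,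
        c / (1 - ‖ζ‖) ≤ bdist Ω (φ 0) / bdist Ω (φ ζ) ∧
        bdist Ω (φ 0) / bdist Ω (φ ζ) ≤ C / (1 - ‖ζ‖) := by
  rcases subsingleton_or_nontrivial (E N) with hN | hN
  · refine ⟨1, 2, one_pos, one_lt_two, fun φ hφ => ?_⟩
    obtain ⟨a, -, ha⟩ := hφ.exists_ne
    exact absurd (Subsingleton.elim _ _) ha
  have hne : (frontier Ω).Nonempty := by
    refine nonempty_frontier_iff.2 ⟨hΩ.2.1.nonempty, fun h => ?_⟩
    have : NoncompactSpace (E N) := NormedSpace.noncompactSpace ℂ (E N)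
    exact NoncompactSpace.noncompact_univ
      (Metric.isCompact_of_isClosed_isBounded isClosed_univ (h ▸ hΩ.2.2.1))
  obtain ⟨r, D, η, c₀, B, hdata⟩ := hΩ.exists_pshData
  obtain ⟨A₁, hA₁, h₁⟩ := hdata.exists_le_bdist hne
  obtain ⟨A₂, -, h₂⟩ := hdata.exists_bdist_le hne
  refine hdata.exists_bdist_bounds (hA₁.trans (le_max_left A₁ A₂))
    (fun x hx => (h₁ x hx).trans ?_) (fun x hx => (h₂ x hx).trans ?_)
  · exact mul_le_mul_of_nonneg_right (le_max_left _ _) infDist_nonneg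
  · exact mul_le_mul_of_nonneg_right (le_max_right _ _) (neg_nonneg.2 (hdata.neg x hx).le)

end InvDist
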